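/- Let u ≤ w be permutations in Σ_n (Bruhat order), and let α = (α₁,…,α_{n−1}) be a composition of ℓ(w)−ℓ(u) with α_i ≤ n−i for all i. Then the coefficient of the monomial x^{δ−α} = x₁^{n−1−α₁}⋯x_{n−1}^{1−α_{n−1}} in the skew Schubert polynomial S_{w/u} equals I_α(u,w), the number of increasing chains in the labeled Bruhat order from u to w of type α. -/

import Mathlib

open MvPolynomial

noncomputable section

/-- The symmetric group `Σ_n` on `{0, …, n-1}` (0-indexed model of `{1, …, n}`). -/
abbrev Perm' (n : ℕ) := Equiv.Perm (Fin n)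

/-- The length `ℓ(w)`: the number of inversions of `w`. -/
def invLength {n : ℕ} (w : Perm' n) : ℕ :=
  (Finset.univ.filter (fun p : Fin n × Fin n => p.1 < p.2 ∧ w p.2 < w p.1)).card

/-- The longest permutation `w₀ = n … 2 1`. -/
def w0 (n : ℕ) : Perm' n := Fin.revPerm

/-- `u ⋖ w` in the Bruhat order: `w = u·(k,l)` where `k < l`, `u k < u l`, and no
position strictly between `k` and `l` has a `u`-value between `u k` and `u l`. -/
def BruhatCover {n : ℕ} (u w : Perm' n) : Prop :=
  ∃ k l : Fin n, k < l ∧ u k < u l ∧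
    (∀ i : Fin n, k < i → i < l → ¬(u k < u i ∧ u i < u l)) ∧
    w = u * Equiv.swap k l

/-- The Bruhat order, generated by its covers. -/
def BruhatLE {n : ℕ} : Perm' n → Perm' n → Prop :=
  Relation.ReflTransGen BruhatCover

/-- `u →^{(k,b)} w` is a labeled cover in the labeled Bruhat order (0-indexed):
`u ⋖ w` with `u⁻¹w = (i,j)`, `i ≤ k < j` and `b = u i`. -/
def IsLabeledCover {n : ℕ} (u w : Perm' n) (k b : ℕ) : Prop :=
  ∃ i j : Fin n, i < j ∧ u i < u j ∧
    (∀ m : Fin n, i < m → m < j → ¬(u i < u m ∧ u m < u j)) ∧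
    w = u * Equiv.swap i j ∧ (i : ℕ) ≤ k ∧ k < (j : ℕ) ∧ b = (u i : ℕ)

/-- Strict lexicographic order on labels `(k,b)`. -/
def lexLt (p q : ℕ × ℕ) : Prop := p.1 < q.1 ∨ (p.1 = q.1 ∧ p.2 < q.2)

/-- A saturated labeled chain of length `m` from `u` to `w` in the labeled Bruhat order. -/
structure LabeledChain (n m : ℕ) (u w : Perm' n) where
  c : Fin (m + 1) → Perm' n
  lab : Fin m → ℕ × ℕ
  c_zero : c 0 = u
  c_last : c (Fin.last m) = w
  step : ∀ i : Fin m, IsLabeledCover (c i.castSucc) (c i.succ) (lab i).1 (lab i).2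

/-- A chain is increasing if its labels strictly increase in lexicographic order. -/
def LabeledChain.Increasing {n m : ℕ} {u w : Perm' n} (γ : LabeledChain n m u w) : Prop :=
  ∀ i j : Fin m, i < j → lexLt (γ.lab i) (γ.lab j)

/-- The type of a chain: `α_k` counts labels with first coordinate `k`. -/
def chainType {n m : ℕ} {u w : Perm' n} (γ : LabeledChain n m u w) : Fin n → ℕ :=
  fun k => (Finset.univ.filter (fun i : Fin m => (γ.lab i).1 = (k : ℕ))).card

/-- `I_α(u,w)`: the number of increasing chains from `u` to `w` of type `α`. -/
def incChainCount (n : ℕ) (u w : Perm' n) (α : Fin n → ℕ) : ℕ :=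
  Nat.card ((m : ℕ) × {γ : LabeledChain n m u w // γ.Increasing ∧ chainType γ = α})

/-- The staircase monomial `x^δ = x₁^{n-1} x₂^{n-2} ⋯ x_{n-1}`. -/
def xDelta (n : ℕ) : MvPolynomial (Fin n) ℤ :=
  ∏ i : Fin n, X i ^ (n - 1 - (i : ℕ))

/-- `S` is the family of Schubert polynomials: `S w₀ = x^δ` and
`S w - s_i·(S w) = (x_i - x_{i+1}) · S (w s_i)` whenever `ℓ(w s_i) < ℓ(w)`. -/
def IsSchubertFamily (n : ℕ) (S : Perm' n → MvPolynomial (Fin n) ℤ) : Prop :=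
  S (w0 n) = xDelta n ∧
  ∀ (w : Perm' n) (i : ℕ) (h : i + 1 < n),
    invLength (w * Equiv.swap (⟨i, by omega⟩ : Fin n) ⟨i + 1, h⟩) < invLength w →
    S w - rename (Equiv.swap (⟨i, by omega⟩ : Fin n) ⟨i + 1, h⟩) (S w) =
      (X (⟨i, by omega⟩ : Fin n) - X ⟨i + 1, h⟩) *
        S (w * Equiv.swap (⟨i, by omega⟩ : Fin n) ⟨i + 1, h⟩)

/-- The ideal generated by the elementary symmetric polynomials `e₁, …, e_n`. -/
def symIdeal (n : ℕ) : Ideal (MvPolynomial (Fin n) ℤ) :=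
  Ideal.span ((fun k => esymm (Fin n) ℤ k) '' Set.Icc 1 n)

/-- `g` is the normal form of `f` modulo the ideal of elementary symmetric polynomials :
`f ≡ g` and every monomial of `g` divides `x^δ`.  (For the degree reverse lexicographic
term order with `x₁ < ⋯ < x_n`, the normal form is exactly the unique such `g`.) -/
def IsNormalForm (n : ℕ) (f g : MvPolynomial (Fin n) ℤ) : Prop :=
  f - g ∈ symIdeal n ∧ ∀ d ∈ g.support, ∀ i : Fin n, d i ≤ n - 1 - (i : ℕ)

def finSubEquiv {n N : ℕ} (h : n ≤ N) : Fin n ≃ {i : Fin N // (i : ℕ) < n} where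
  toFun i := ⟨Fin.castLE h i, i.isLt⟩
  invFun j := ⟨(j.1 : ℕ), j.2⟩
  left_inv i := rfl
  right_inv j := rfl

/-- The standard inclusion `Σ_n ⊂ Σ_N`, extending a permutation by fixed points. -/
def permIncl {n N : ℕ} (h : n ≤ N) (u : Perm' n) : Perm' N :=
  u.extendDomain (finSubEquiv h)

/-- `δ` as an exponent vector. -/
def deltaF (n : ℕ) : Fin n →₀ ℕ :=
  Finsupp.equivFunOnFinite.symm fun i => n - 1 - (i : ℕ)

/-- The type of a chain as an exponent vector. -/
def chainTypeF {n m : ℕ} {u w : Perm' n} (γ : LabeledChain n m u w) : Fin n →₀ ℕ :=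
  Finsupp.equivFunOnFinite.symm (chainType γ)

/-- `δ` as an integral exponent vector. -/
def deltaZ (n : ℕ) : Fin n →₀ ℤ :=
  Finsupp.equivFunOnFinite.symm fun i => ((n - 1 - (i : ℕ) : ℕ) : ℤ)

/-- The type of a chain as an integral exponent vector. -/
def chainTypeZ {n m : ℕ} {u w : Perm' n} (γ : LabeledChain n m u w) : Fin n →₀ ℤ :=
  Finsupp.equivFunOnFinite.symm fun k => ((chainType γ k : ℕ) : ℤ)

/-- The inclusion of polynomials into Laurent polynomials. -/
def toLaurent (n : ℕ) : MvPolynomial (Fin n) ℤ →+* AddMonoidAlgebra ℤ (Fin n →₀ ℤ) :=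
  AddMonoidAlgebra.mapDomainRingHom ℤ (Finsupp.mapRange.addMonoidHom (Nat.castAddMonoidHom ℤ))

/-- The complete homogeneous symmetric polynomial `h_a(x₁, …, x_k)` inside
`ℤ[x₁, …, x_n]` (variables are 0-indexed, so the first `k` variables are used). -/
def hpoly (n k a : ℕ) : MvPolynomial (Fin n) ℤ :=
  ∑ s ∈ (Finset.univ.filter (fun i : Fin n => (i : ℕ) < k)).sym a,
    ((s : Multiset (Fin n)).map X).prod

/-- `h_α = h_{α₁}(x₁) h_{α₂}(x₁,x₂) ⋯ h_{α_{n-1}}(x₁, …, x_{n-1})` (0-indexed `α`). -/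
def hAlpha (n : ℕ) (α : Fin n → ℕ) : MvPolynomial (Fin n) ℤ :=
  ∏ i : Fin n, hpoly n ((i : ℕ) + 1) (α i)

/- ## rc-graphs (0-indexed pairs: the paper's pair `(k,b)` is `(k-1, b-1)`) -/

/-- The linear order on rc-graph positions: `(k,b) ≤ (j,a)  ⇔  k < j, or k = j and b ≥ a`. -/
def rcLE (p q : ℕ × ℕ) : Prop := p.1 < q.1 ∨ (p.1 = q.1 ∧ q.2 ≤ p.2)

instance : DecidableRel rcLE := fun p q => by unfold rcLE; exact inferInstance
instance : IsTrans (ℕ × ℕ) rcLE :=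
  ⟨fun a b c h1 h2 => by unfold rcLE at h1 h2 ⊢; omega⟩
instance : IsAntisymm (ℕ × ℕ) rcLE :=
  ⟨fun a b h1 h2 => by unfold rcLE at h1 h2; rw [Prod.ext_iff]; omega⟩
instance : IsTotal (ℕ × ℕ) rcLE := ⟨fun a b => by unfold rcLE; omega⟩

/-- The adjacent transposition `s_{i+1} = (i, i+1)` (0-indexed positions). -/
def adjT (n : ℕ) (i : ℕ) : Perm' n :=
  if h : i + 1 < n then Equiv.swap ⟨i, by omega⟩ ⟨i + 1, h⟩ else 1

/-- The word `d(R)` of a set of positions: list its elements in the order `rcLE` and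
record `k + b` for each pair (0-indexed version of `k + b - 1`). -/
def rcWord (R : Finset (ℕ × ℕ)) : List ℕ :=
  (R.sort rcLE).map (fun p => p.1 + p.2)

/-- The permutation given by a word in the adjacent transpositions. -/
def wordPerm (n : ℕ) (l : List ℕ) : Perm' n :=
  (l.map (adjT n)).prod

/-- The permutation of a set of rc-positions. -/
def rcPerm (n : ℕ) (R : Finset (ℕ × ℕ)) : Perm' n := wordPerm n (rcWord R)

/-- `R` consists of valid rc-positions: (0-indexed) `k + b + 2 ≤ n`. -/
def IsRC (n : ℕ) (R : Finset (ℕ × ℕ)) : Prop := ∀ p ∈ R, p.1 + p.2 + 2 ≤ n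

/-- `R ∈ 𝓡(w)`: `R` is an rc-graph associated to `w`, i.e. `d(R)` is a reduced word for `w`. -/
def AssocRC (n : ℕ) (R : Finset (ℕ × ℕ)) (w : Perm' n) : Prop :=
  IsRC n R ∧ rcPerm n R = w ∧ R.card = invLength w

/-- All valid rc-positions for `Σ_n`. -/
def fullRC (n : ℕ) : Finset (ℕ × ℕ) :=
  (Finset.range n ×ˢ Finset.range n).filter (fun p => p.1 + p.2 + 2 ≤ n)

/-- One greedy step: adjoin the lexicographically smallest valid pair not in `R`. -/
def GreedyStep (n : ℕ) (R R' : Finset (ℕ × ℕ)) : Prop :=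
  ∃ p : ℕ × ℕ, p ∉ R ∧ p.1 + p.2 + 2 ≤ n ∧
    (∀ q : ℕ × ℕ, q.1 + q.2 + 2 ≤ n → q ∉ R → (p.1 < q.1 ∨ (p.1 = q.1 ∧ p.2 ≤ q.2))) ∧
    R' = insert p R

/-- The exponent of `x_i` in `x^R`. -/
def rcType (n : ℕ) (R : Finset (ℕ × ℕ)) : Fin n → ℕ :=
  fun i => (R.filter (fun p => p.1 = (i : ℕ))).card

/-- `γ = γ(R)`: the chain `γ` is produced from `R` by the greedy sequence. -/
def GreedyRel (n : ℕ) {m : ℕ} (w : Perm' n) (R : Finset (ℕ × ℕ))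
    (γ : LabeledChain n m w (w0 n)) : Prop :=
  ∃ Rs : ℕ → Finset (ℕ × ℕ), Rs 0 = R ∧
    (∀ i < m, GreedyStep n (Rs i) (Rs (i + 1))) ∧
    (∀ i : Fin m, γ.lab i ∉ Rs (i : ℕ) ∧ Rs ((i : ℕ) + 1) = insert (γ.lab i) (Rs (i : ℕ))) ∧
    (∀ i : Fin (m + 1), rcPerm n (Rs (i : ℕ)) = γ.c i)

/-- `Cov u i j` says that `u ⋖ u·(i,j)` is a Bruhat cover. -/
def Cov {n : ℕ} (u : Perm' n) (i j : Fin n) : Prop :=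
  i < j ∧ u i < u j ∧ ∀ m : Fin n, i < m → m < j → ¬(u i < u m ∧ u m < u j)

lemma mul_swap_apply {n : ℕ} (u : Perm' n) (a b m : Fin n) :
    (u * Equiv.swap a b) m = if m = a then u b else if m = b then u a else u m := by
  rw [Equiv.Perm.mul_apply, Equiv.swap_apply_def]; split_ifs <;> rfl

lemma cov_disjoint_right {n : ℕ} (u : Perm' n) {i k j l : Fin n} (hik : i < k) (hj : k < j)
    (hl : k < l) (hjl : j ≠ l) :
    (u i < u k ∧ Cov u k l ∧ Cov (u * Equiv.swap k l) i j) ↔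
      (u i < u k ∧ Cov u i j ∧ Cov (u * Equiv.swap i j) k l) := by
  have hu : ∀ a b, u a = u b → a = b := fun a b h => u.injective h
  simp only [Cov, mul_swap_apply]
  constructor
  · rintro ⟨h0, ⟨h1, h2, h3⟩, h4, h5, h6⟩
    have a1 := h6 k hik hj
    have a2 := h3 j hj
    have a3 := h6 l
    refine ⟨h0, ⟨h4, ?_, ?_⟩, h1, ?_, ?_⟩
    all_goals grind (splits := 40)
  · rintro ⟨h0, ⟨h4, h5, h6⟩, h1, h2, h3⟩
    have a1 := h6 k hik hj
    refine ⟨h0, ⟨h1, ?_, ?_⟩, h4, ?_, ?_⟩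
    all_goals grind (splits := 40)

lemma cov_disjoint_left {n : ℕ} (u : Perm' n) {i k j m : Fin n} (hik : i < k) (hj : k < j)
    (hm : m < k) (hmi : m ≠ i) :
    (u i < u m ∧ Cov u m k ∧ Cov (u * Equiv.swap m k) i j) ↔
      (u i < u m ∧ Cov u i j ∧ Cov (u * Equiv.swap i j) m k) := by
  have hu : ∀ a b, u a = u b → a = b := fun a b h => u.injective h
  simp only [Cov, mul_swap_apply]
  constructor
  · rintro ⟨h0, ⟨h1, h2, h3⟩, h4, h5, h6⟩
    have a1 := h6 k hik hj
    refine ⟨h0, ⟨h4, ?_, ?_⟩, h1, ?_, ?_⟩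
    all_goals grind (splits := 40)
  · rintro ⟨h0, ⟨h4, h5, h6⟩, h1, h2, h3⟩
    have a1 := h6 k hik hj
    have a2 := h6 m
    have a3 := h3 i
    refine ⟨h0, ⟨h1, ?_, ?_⟩, h4, ?_, ?_⟩
    all_goals grind (splits := 40)

lemma cov_triple {n : ℕ} (u : Perm' n) {i k l : Fin n} (hik : i < k) (hl : k < l) :
    (Cov u i k ∧ Cov (u * Equiv.swap i k) k l) ↔
      ((u i < u k ∧ Cov u k l ∧ Cov (u * Equiv.swap k l) i l) ∨
        (Cov u i l ∧ Cov (u * Equiv.swap i l) i k)) := by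
  have hu : ∀ a b, u a = u b → a = b := fun a b h => u.injective h
  simp only [Cov, mul_swap_apply]
  constructor
  · rintro ⟨⟨h1, h2, h3⟩, h4, h5, h6⟩
    have := hu k l
    rcases lt_or_ge (u k) (u l) with h | h
    · left
      refine ⟨h2, ⟨hl, h, ?_⟩, hik.trans hl, ?_, ?_⟩
      all_goals grind (splits := 40)
    · right
      refine ⟨⟨hik.trans hl, ?_, ?_⟩, hik, ?_, ?_⟩
      all_goals grind (splits := 40)
  · rintro (⟨h0, ⟨h1, h2, h3⟩, h4, h5, h6⟩ | ⟨⟨h1, h2, h3⟩, h4, h5, h6⟩)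
    · refine ⟨⟨hik, h0, ?_⟩, hl, ?_, ?_⟩
      all_goals grind (splits := 40)
    · have := h3 k
      refine ⟨⟨hik, ?_, ?_⟩, hl, ?_, ?_⟩
      all_goals grind (splits := 40)

lemma cov_triple_disjoint {n : ℕ} (u : Perm' n) {i k l : Fin n} (hik : i < k) (hl : k < l)
    (h : Cov u k l) : ¬ Cov (u * Equiv.swap i l) i k := by
  simp only [Cov, mul_swap_apply] at h ⊢
  grind

lemma cov_conj_iff {n : ℕ} (u : Perm' n) {a b : Fin n} (hab : (a : ℕ) + 1 = b) (hu : u a < u b)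
    (k j : Fin n) :
    (Cov (u * Equiv.swap a b) (Equiv.swap a b k) (Equiv.swap a b j) ∧
        (u * Equiv.swap k j) a < (u * Equiv.swap k j) b) ↔
      (Cov u k j ∧ ¬ (k = a ∧ j = b)) := by
  have hinj : ∀ a b, u a = u b → a = b := fun a b h => u.injective h
  have key : Cov (u * Equiv.swap a b) (Equiv.swap a b k) (Equiv.swap a b j) ↔
      Equiv.swap a b k < Equiv.swap a b j ∧ u k < u j ∧
        ∀ m, Equiv.swap a b k < Equiv.swap a b m → Equiv.swap a b m < Equiv.swap a b j →
          ¬(u k < u m ∧ u m < u j) := by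
    unfold Cov
    rw [(Equiv.swap a b).forall_congr_left]
    simp
  rw [key]
  simp only [Cov, mul_swap_apply, Equiv.swap_apply_def]
  constructor
  · rintro ⟨⟨h1, h2, h3⟩, h4⟩
    have a1 := h3 a
    have a2 := h3 b
    refine ⟨⟨?_, h2, fun m => ?_⟩, ?_⟩
    · clear h3 a1 a2
      grind (splits := 40)
    · have a3 := h3 m
      clear h3
      grind (splits := 60)
    · clear h3 a1 a2
      grind (splits := 40)
  · rintro ⟨⟨h1, h2, h3⟩, h4⟩
    have a1 := h3 a
    have a2 := h3 b
    refine ⟨⟨?_, h2, fun m => ?_⟩, ?_⟩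
    · clear h3 a1 a2
      grind (splits := 40)
    · have a3 := h3 m
      clear h3
      grind (splits := 60)
    · clear h3
      grind (splits := 40)

/-- The Lehmer code of a permutation. -/
def code {n : ℕ} (w : Perm' n) (m : Fin n) : ℕ :=
  (Finset.univ.filter fun x : Fin n => m < x ∧ w x < w m).card

lemma invLength_eq_sum_code {n : ℕ} (w : Perm' n) : invLength w = ∑ m, code w m := by
  simp only [invLength, code, Finset.card_filter, Fintype.sum_prod_type]

section Ascent

variable {n : ℕ} {w : Perm' n} {a b : Fin n}

lemma code_mul_swap_left (hab : (a : ℕ) + 1 = b) (h : w a < w b) :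
    code (w * Equiv.swap a b) a = code w b + 1 := by
  have : (Finset.univ.filter fun x : Fin n => a < x ∧ (w * Equiv.swap a b) x <
      (w * Equiv.swap a b) a) =
      insert b (Finset.univ.filter fun x : Fin n => b < x ∧ w x < w b) := by
    ext x
    simp only [mul_swap_apply, Finset.mem_filter, Finset.mem_univ, true_and, Finset.mem_insert]
    grind
  rw [code, this, Finset.card_insert_of_notMem (by simp), code]

lemma code_mul_swap_right (hab : (a : ℕ) + 1 = b) (h : w a < w b) :
    code (w * Equiv.swap a b) b = code w a := by
  unfold code
  congr 1
  ext x
  simp only [mul_swap_apply, Finset.mem_filter, Finset.mem_univ, true_and]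
  grind

lemma code_mul_swap_of_ne (hab : (a : ℕ) + 1 = b) {m : Fin n} (ha : m ≠ a) (hb : m ≠ b) :
    code (w * Equiv.swap a b) m = code w m := by
  unfold code
  refine Finset.card_equiv (Equiv.swap a b) fun x => ?_
  simp only [Finset.mem_filter, Finset.mem_univ, true_and, Equiv.Perm.mul_apply,
    Equiv.swap_apply_of_ne_of_ne ha hb]
  refine and_congr_left fun _ => ?_
  rw [Equiv.swap_apply_def]
  grind

lemma invLength_mul_swap (hab : (a : ℕ) + 1 = b) (h : w a < w b) :
    invLength (w * Equiv.swap a b) = invLength w + 1 := by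
  have hne : b ≠ a := by rintro rfl; omega
  rw [invLength_eq_sum_code, invLength_eq_sum_code,
    ← Finset.add_sum_erase _ _ (Finset.mem_univ a),
    ← Finset.add_sum_erase _ _ (Finset.mem_erase.2 ⟨hne, Finset.mem_univ b⟩),
    ← Finset.add_sum_erase _ (code w) (Finset.mem_univ a),
    ← Finset.add_sum_erase _ (code w) (Finset.mem_erase.2 ⟨hne, Finset.mem_univ b⟩),
    code_mul_swap_left hab h, code_mul_swap_right hab h,
    Finset.sum_congr rfl fun m hm => code_mul_swap_of_ne (w := w) hab
      (m := m) (by simp_all) (by simp_all)]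
  ring

end Ascent

lemma invLength_le {n : ℕ} (w : Perm' n) : invLength w ≤ n * n := by
  unfold invLength
  exact (Finset.card_le_univ _).trans (by simp)

lemma perm_eq_one_of_le {n : ℕ} {σ : Perm' n} (h : ∀ i, σ i ≤ i) : σ = 1 := by
  have hs : ∑ i, (σ i : ℕ) = ∑ i : Fin n, (i : ℕ) := Equiv.sum_comp σ fun i : Fin n => (i : ℕ)
  have := (Finset.sum_eq_sum_iff_of_le fun i _ => Fin.le_def.1 (h i)).1 hs
  ext i
  exact this i (Finset.mem_univ i)

lemma eq_one_of_forall_lt {n : ℕ} {w : Perm' n}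
    (h : ∀ a b : Fin n, (a : ℕ) + 1 = b → w a < w b) : w = 1 := by
  have hm : StrictMono w := by
    rcases n with _ | n
    · intro a; exact a.elim0
    · exact Fin.strictMono_iff_lt_succ.2 fun i => h _ _ (by simp)
  have hle : ∀ i, i ≤ w i := fun i => by
    simpa using hm.le_apply
  refine inv_eq_one.1 (perm_eq_one_of_le fun i => ?_)
  simpa using hle (w⁻¹ i)

lemma w0_mul_apply {n : ℕ} (w : Perm' n) (i : Fin n) : (w0 n * w) i = (w i).rev := rfl

lemma w0_mul_w0_mul {n : ℕ} (w : Perm' n) : w0 n * (w0 n * w) = w := by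
  ext i; simp [w0_mul_apply]

lemma exists_ascent {n : ℕ} {w : Perm' n} (h : w ≠ w0 n) :
    ∃ a b : Fin n, (a : ℕ) + 1 = b ∧ w a < w b := by
  by_contra! hc
  refine h ?_
  have : w0 n * w = 1 := eq_one_of_forall_lt fun a b hab => by
    have hne : w b ≠ w a := fun e => by
      have := w.injective e
      subst this; omega
    simpa [w0_mul_apply] using lt_of_le_of_ne (hc a b hab) hne
  rw [← w0_mul_w0_mul w, this, mul_one]

lemma exists_descent {n : ℕ} {w : Perm' n} (h : w ≠ 1) :
    ∃ a b : Fin n, (a : ℕ) + 1 = b ∧ w b < w a := by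
  by_contra! hc
  refine h (eq_one_of_forall_lt fun a b hab => lt_of_le_of_ne (hc a b hab) fun e => ?_)
  have := w.injective e
  subst this; omega

/-- Induction from the longest permutation down along ascents. -/
lemma descending_induction {n : ℕ} {P : Perm' n → Prop} (base : P (w0 n))
    (step : ∀ (w : Perm' n) (a b : Fin n), (a : ℕ) + 1 = b → w a < w b →
      P (w * Equiv.swap a b) → P w) (w : Perm' n) : P w := by
  induction hk : n * n - invLength w using Nat.strong_induction_on generalizing w with
  | _ k ih =>
    by_cases hw : w = w0 n
    · exact hw ▸ base
    · obtain ⟨a, b, hab, h⟩ := exists_ascent hw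
      have h1 := invLength_mul_swap hab h
      have h2 := invLength_le (w * Equiv.swap a b)
      exact step w a b hab h (ih _ (by omega) _ rfl)

lemma invLength_pos {n : ℕ} {w : Perm' n} (h : w ≠ 1) : 0 < invLength w := by
  obtain ⟨a, b, hab, hw⟩ := exists_descent h
  refine Finset.card_pos.2 ⟨(a, b), ?_⟩
  simp only [Finset.mem_filter, Finset.mem_univ, true_and]
  exact ⟨Fin.lt_def.2 (by omega), hw⟩

lemma code_one {n : ℕ} (m : Fin n) : code (1 : Perm' n) m = 0 := by
  simp only [code, Finset.card_eq_zero, Finset.filter_eq_empty_iff]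
  intro x _ h
  exact absurd h.1 (not_lt.2 h.2.le)

lemma code_w0 {n : ℕ} (m : Fin n) : code (w0 n) m = n - 1 - m := by
  have : (Finset.univ.filter fun x : Fin n => m < x ∧ w0 n x < w0 n m) = Finset.Ioi m := by
    ext x; simp [w0]
  rw [code, this, Fin.card_Ioi]

lemma w0_ascent_false {n : ℕ} {a b : Fin n} (h : a < b) : ¬ w0 n a < w0 n b := by
  simp [w0, h.le]

/-- The exponent `σ` acting on the staircase: `i ↦ n - 1 - σ i`. -/
def expo {n : ℕ} (σ : Perm' n) : Fin n →₀ ℕ :=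
  Finsupp.equivFunOnFinite.symm fun i => n - 1 - (σ i : ℕ)

@[simp] lemma expo_apply {n : ℕ} (σ : Perm' n) (i : Fin n) : expo σ i = n - 1 - (σ i : ℕ) := rfl

/-- The coefficient of the staircase monomial in the antisymmetrization of `f`. -/
def top {n : ℕ} {R : Type*} [CommRing R] : MvPolynomial (Fin n) R →ₗ[R] R :=
  ∑ σ : Perm' n, (Equiv.Perm.sign σ : ℤ) • lcoeff R (expo σ)

lemma top_apply {n : ℕ} {R : Type*} [CommRing R] (f : MvPolynomial (Fin n) R) :
    top f = ∑ σ : Perm' n, (Equiv.Perm.sign σ : ℤ) • coeff (expo σ) f := by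
  simp [top]

section CommRing

variable {n : ℕ} {R : Type*} [CommRing R] {a b : Fin n} {f f' g g' : MvPolynomial (Fin n) R}

lemma top_rename (hab : a ≠ b) (f : MvPolynomial (Fin n) R) :
    top (rename (Equiv.swap a b) f) = -top f := by
  rw [top_apply, top_apply, ← Finset.sum_neg_distrib]
  refine Fintype.sum_equiv (Equiv.mulRight (Equiv.swap a b)) _ _ fun σ => ?_
  have : expo σ = (expo (σ * Equiv.swap a b)).mapDomain (Equiv.swap a b) := by
    ext i
    simp [Finsupp.mapDomain_equiv_apply]
  rw [this, coeff_rename_mapDomain _ (Equiv.injective _)]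
  simp [Equiv.Perm.sign_mul, Equiv.Perm.sign_swap hab]

lemma top_monomial_mul (g : MvPolynomial (Fin n) R) :
    top (monomial (expo 1) 1 * g) = constantCoeff g := by
  rw [top_apply, Finset.sum_eq_single 1]
  · simp [coeff_monomial_mul', constantCoeff_eq]
  · intro σ _ hσ
    rw [coeff_monomial_mul', if_neg, smul_zero]
    intro h
    refine hσ (perm_eq_one_of_le fun i => Fin.le_def.2 ?_)
    have := h i
    simp only [expo_apply, Equiv.Perm.one_apply] at this
    omega
  · simp

/-- `f'` is the divided difference of `f` with respect to the transposition of `a` and `b`. -/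
def IsDivDiff (a b : Fin n) (f f' : MvPolynomial (Fin n) R) : Prop :=
  f - rename (Equiv.swap a b) f = (X a - X b) * f'

lemma exists_isDivDiff (a b : Fin n) (f : MvPolynomial (Fin n) R) : ∃ f', IsDivDiff a b f f' := by
  unfold IsDivDiff
  induction f using MvPolynomial.induction_on with
  | C r => exact ⟨0, by simp⟩
  | add p q hp hq =>
    obtain ⟨p', hp⟩ := hp
    obtain ⟨q', hq⟩ := hq
    exact ⟨p' + q', by rw [map_add, mul_add, ← hp, ← hq]; ring⟩
  | mul_X p i hp =>
    obtain ⟨p', hp⟩ := hp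
    simp only [map_mul, rename_X]
    by_cases ha : i = a
    · refine ⟨p' * X a + rename (Equiv.swap a b) p, ?_⟩
      subst ha
      rw [Equiv.swap_apply_left]
      linear_combination X i * hp
    · by_cases hb : i = b
      · refine ⟨p' * X b - rename (Equiv.swap a b) p, ?_⟩
        subst hb
        rw [Equiv.swap_apply_right]
        linear_combination X i * hp
      · refine ⟨p' * X i, ?_⟩
        rw [Equiv.swap_apply_of_ne_of_ne ha hb]
        linear_combination X i * hp

lemma IsDivDiff.rename_mul {p : MvPolynomial (Fin n) R} (hp : rename (Equiv.swap a b) p = p)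
    (h : IsDivDiff a b f f') : IsDivDiff a b (p * f) (p * f') := by
  unfold IsDivDiff at *
  rw [map_mul, hp]
  linear_combination p * h

lemma isDivDiff_zero (hf : rename (Equiv.swap a b) f = f) : IsDivDiff a b f 0 := by
  simp [IsDivDiff, hf]

end CommRing

section Domain

variable {n : ℕ} {R : Type*} [CommRing R] [IsDomain R] {a b : Fin n}
  {f f' g g' : MvPolynomial (Fin n) R}

lemma X_sub_X_ne_zero (hab : a ≠ b) : (X a - X b : MvPolynomial (Fin n) R) ≠ 0 :=
  sub_ne_zero.2 fun h => hab (X_injective h)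

lemma IsDivDiff.rename_eq (hab : a ≠ b) (h : IsDivDiff a b f f') :
    rename (Equiv.swap a b) f' = f' := by
  unfold IsDivDiff at h
  have h2 := congrArg (rename (Equiv.swap a b)) h
  simp only [map_sub, map_mul, rename_X, Equiv.swap_apply_left, Equiv.swap_apply_right,
    rename_rename, ← Equiv.coe_trans, Equiv.swap_swap, Equiv.coe_refl, rename_id_apply] at h2
  refine mul_left_cancel₀ (X_sub_X_ne_zero hab) ?_
  linear_combination h2 + h

lemma IsDivDiff.eq_zero (hab : a ≠ b) (h : IsDivDiff a b f f')
    (hf : rename (Equiv.swap a b) f = f) : f' = 0 := by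
  unfold IsDivDiff at h
  rw [hf, sub_self, zero_eq_mul] at h
  exact h.resolve_left (X_sub_X_ne_zero hab)

lemma isHomogeneous_of_mul {L : MvPolynomial (Fin n) R} (hL : L.IsHomogeneous 1) (h0 : L ≠ 0)
    {m : ℕ} (h : (L * g).IsHomogeneous (1 + m)) : g.IsHomogeneous m := by
  let _ := MvPolynomial.gradedAlgebra (σ := Fin n) (R := R)
  have h1 := DirectSum.coe_decompose_mul_add_of_left_mem (homogeneousSubmodule (Fin n) R)
    (j := m) (b := g) ((mem_homogeneousSubmodule _ _).2 hL)
  have h2 : (DirectSum.decompose (homogeneousSubmodule (Fin n) R) (L * g) (1 + m) :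
      MvPolynomial (Fin n) R) = L * g :=
    DirectSum.decompose_of_mem_same _ ((mem_homogeneousSubmodule _ _).2 h)
  rw [h2] at h1
  rw [mul_left_cancel₀ h0 h1, ← mem_homogeneousSubmodule]
  exact SetLike.coe_mem _

variable [CharZero R]

lemma top_eq_zero_of_rename_eq (hab : a ≠ b) (hf : rename (Equiv.swap a b) f = f) :
    top f = 0 := by
  have := top_rename hab f
  rw [hf] at this
  exact self_eq_neg.1 this

lemma IsDivDiff.top_mul (hab : a ≠ b) (hf : IsDivDiff a b f f') (hg : IsDivDiff a b g g') :
    top (f' * g) = top (f * g') := by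
  rw [← sub_eq_zero, ← map_sub]
  refine top_eq_zero_of_rename_eq hab ?_
  have hf' := hf.rename_eq hab
  have hg' := hg.rename_eq hab
  unfold IsDivDiff at hf hg
  rw [map_sub, map_mul, map_mul, hf', hg']
  linear_combination g' * hf - f' * hg

end Domain

/-- Schubert polynomials with coefficients in `R`, with divided differences along ascents. -/
structure IsFam {n : ℕ} {R : Type*} [CommRing R] (S : Perm' n → MvPolynomial (Fin n) R) :
    Prop where
  base : S (w0 n) = monomial (expo 1) 1
  step : ∀ {w : Perm' n} {a b : Fin n}, (a : ℕ) + 1 = b → w a < w b →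
    IsDivDiff a b (S (w * Equiv.swap a b)) (S w)

lemma xDelta_eq (n : ℕ) : xDelta n = monomial (expo 1) 1 := by
  rw [monomial_eq, C_1, one_mul, Finsupp.prod_fintype _ _ (by simp)]
  rfl

lemma IsSchubertFamily.isFam {n : ℕ} {S : Perm' n → MvPolynomial (Fin n) ℤ}
    (hS : IsSchubertFamily n S) : IsFam S where
  base := by rw [hS.1, xDelta_eq]
  step := by
    intro w a b hab h
    obtain ⟨a, ha⟩ := a
    obtain ⟨b, hb⟩ := b
    obtain rfl : a + 1 = b := hab
    have := hS.2 (w * Equiv.swap ⟨a, ha⟩ ⟨a + 1, hb⟩) a hb (by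
      rw [mul_assoc, Equiv.swap_mul_self, mul_one, invLength_mul_swap rfl h]
      omega)
    rwa [mul_assoc, Equiv.swap_mul_self, mul_one] at this

lemma IsFam.map {n : ℕ} {R R' : Type*} [CommRing R] [CommRing R']
    {S : Perm' n → MvPolynomial (Fin n) R} (hS : IsFam S) (φ : R →+* R') :
    IsFam fun w => MvPolynomial.map φ (S w) where
  base := by rw [hS.base, map_monomial, map_one]
  step := by
    intro w a b hab h
    have := congrArg (MvPolynomial.map φ) (hS.step hab h)
    simpa only [IsDivDiff, map_sub, map_mul, map_rename, map_X] using this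

lemma ne_of_succ_eq {n : ℕ} {a b : Fin n} (hab : (a : ℕ) + 1 = b) : a ≠ b := by
  rintro rfl; omega

/-- The Lehmer code as an exponent vector. -/
def codeF {n : ℕ} (w : Perm' n) : Fin n →₀ ℕ := Finsupp.equivFunOnFinite.symm (code w)

@[simp] lemma codeF_apply {n : ℕ} (w : Perm' n) (i : Fin n) : codeF w i = code w i := rfl

lemma codeF_w0 (n : ℕ) : codeF (w0 n) = expo 1 := by
  ext i; simp [code_w0]

lemma codeF_one (n : ℕ) : codeF (1 : Perm' n) = 0 := by
  ext i; simp [code_one]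

lemma code_le_of_ascent {n : ℕ} {w : Perm' n} {a b : Fin n} (hab : (a : ℕ) + 1 = b)
    (h : w a < w b) : code w a ≤ code w b := by
  refine Finset.card_le_card fun x hx => ?_
  simp only [Finset.mem_filter, Finset.mem_univ, true_and] at hx ⊢
  grind

lemma code_lt_of_descent {n : ℕ} {w : Perm' n} {a b : Fin n} (hab : (a : ℕ) + 1 = b)
    (h : w b < w a) : code w b < code w a := by
  refine Finset.card_lt_card ((Finset.ssubset_iff_of_subset fun x hx => ?_).2 ⟨b, ?_, ?_⟩)
  · simp only [Finset.mem_filter, Finset.mem_univ, true_and] at hx ⊢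
    grind
  · simp only [Finset.mem_filter, Finset.mem_univ, true_and]
    grind
  · simp

section Domain

variable {n : ℕ} {R : Type*} [CommRing R] [IsDomain R] {S : Perm' n → MvPolynomial (Fin n) R}
  {a b : Fin n} {w : Perm' n}

lemma IsFam.rename_eq (hS : IsFam S) (hab : (a : ℕ) + 1 = b) (h : w a < w b) :
    rename (Equiv.swap a b) (S w) = S w :=
  (hS.step hab h).rename_eq (ne_of_succ_eq hab)

lemma IsFam.dominant (hS : IsFam S) (w : Perm' n)
    (hw : ∀ a b : Fin n, (a : ℕ) + 1 = b → code w b ≤ code w a) :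
    S w = monomial (codeF w) 1 := by
  induction hk : n * n - invLength w using Nat.strong_induction_on generalizing w with
  | _ k ih =>
    by_cases hw0 : w = w0 n
    · rw [hw0, hS.base, codeF_w0]
    obtain ⟨a, ⟨b, hab, h⟩, hmin⟩ : ∃ a : Fin n, (∃ b : Fin n, (a : ℕ) + 1 = b ∧ w a < w b) ∧
        ∀ a', a' < a → ∀ b : Fin n, (a' : ℕ) + 1 = b → w b < w a' := by
      obtain ⟨a, ha, hmin⟩ := Finset.exists_minimal
        (s := Finset.univ.filter fun a : Fin n => ∃ b : Fin n, (a : ℕ) + 1 = b ∧ w a < w b) (by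
          obtain ⟨a, b, h⟩ := exists_ascent hw0
          exact ⟨a, by simpa using ⟨b, h⟩⟩)
      refine ⟨a, by simpa using ha, fun a' ha' b hb => ?_⟩
      by_contra hc
      have hne : w a' ≠ w b := fun e => ne_of_succ_eq hb (w.injective e)
      have := hmin (y := a') (by simpa using ⟨b, hb, lt_of_le_of_ne (not_lt.1 hc) hne⟩) ha'.le
      exact absurd ha' (not_lt.2 this)
    have hne := ne_of_succ_eq hab
    have hcode : code w a = code w b := le_antisymm (code_le_of_ascent hab h) (hw a b hab)
    have hlen := invLength_mul_swap hab h
    have hle := invLength_le (w * Equiv.swap a b)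
    have hL := code_mul_swap_left hab h
    have hR := code_mul_swap_right hab h
    have hO := fun m => code_mul_swap_of_ne (w := w) hab (m := m)
    have hS' := ih _ (by omega) (w * Equiv.swap a b) (fun c d hcd => by
      have h1 := hw c d hcd
      have h2 : c < a → code w d < code w c := fun hc => code_lt_of_descent hcd (hmin c hc d hcd)
      by_cases hca : c = a
      · obtain rfl : d = b := Fin.ext (by omega)
        subst hca; omega
      · by_cases hcb : c = b
        · have hda : d ≠ a := by rintro rfl; omega
          have hdb : d ≠ b := by rintro rfl; omega
          have := hO d hda hdb
          subst hcb; omega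
        · have hdb : d ≠ b := by rintro rfl; exact hca (Fin.ext (by omega))
          have := hO c hca hcb
          by_cases hda : d = a
          · subst hda
            have := h2 (Fin.lt_def.2 (by omega))
            omega
          · have := hO d hda hdb
            omega) rfl
    have hstep := hS.step hab h
    have hm : monomial (codeF (w * Equiv.swap a b)) (1 : R) = X a * monomial (codeF w) 1 := by
      rw [X, monomial_mul, one_mul]
      refine congrArg (fun d => monomial d (1 : R)) ?_
      ext m
      simp only [codeF_apply, Finsupp.add_apply, Finsupp.single_apply]
      grind
    have hr : rename (Equiv.swap a b) (monomial (codeF w) (1 : R)) = monomial (codeF w) 1 := by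
      rw [rename_monomial]
      refine congrArg (fun d => monomial d (1 : R)) ?_
      ext m
      rw [Finsupp.mapDomain_equiv_apply, Equiv.symm_swap, codeF_apply, codeF_apply,
        Equiv.swap_apply_def]
      grind
    unfold IsDivDiff at hstep
    rw [hS', hm, map_mul, hr, rename_X, Equiv.swap_apply_left] at hstep
    refine mul_left_cancel₀ (X_sub_X_ne_zero hne) ?_
    rw [← hstep]; ring

lemma IsFam.one (hS : IsFam S) : S 1 = 1 := by
  rw [hS.dominant 1 (by simp [code_one]), codeF_one, monomial_zero', C_1]

lemma IsFam.isHomogeneous (hS : IsFam S) (w : Perm' n) : (S w).IsHomogeneous (invLength w) := by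
  induction w using descending_induction with
  | base =>
    rw [hS.base]
    refine isHomogeneous_monomial _ ?_
    rw [invLength_eq_sum_code, ← codeF_w0, Finsupp.degree_eq_sum]
    rfl
  | step w a b hab h ih =>
    have hstep := hS.step hab h
    rw [invLength_mul_swap hab h, add_comm] at ih
    refine isHomogeneous_of_mul ((isHomogeneous_X R a).sub (isHomogeneous_X R b))
      (X_sub_X_ne_zero (ne_of_succ_eq hab)) ?_
    rw [← show _ = _ from hstep]
    exact ih.sub ih.rename_isHomogeneous

lemma IsFam.constantCoeff (hS : IsFam S) (w : Perm' n) :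
    constantCoeff (S w) = if w = 1 then 1 else 0 := by
  split_ifs with h
  · rw [h, hS.one, map_one]
  · rw [constantCoeff_eq]
    exact (hS.isHomogeneous w).coeff_eq_zero (by simpa using (invLength_pos h).ne)

variable [CharZero R]

lemma IsFam.top_mul_S_of_ascent (hS : IsFam S) (hab : (a : ℕ) + 1 = b) (h : w a < w b)
    {f f' : MvPolynomial (Fin n) R} (hf : IsDivDiff a b f f') :
    top (f' * S (w * Equiv.swap a b)) = top (f * S w) :=
  hf.top_mul (ne_of_succ_eq hab) (hS.step hab h)

lemma IsFam.top_mul_S_of_ascent' (hS : IsFam S) (hab : (a : ℕ) + 1 = b) (h : w a < w b)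
    {f f' : MvPolynomial (Fin n) R} (hf : IsDivDiff a b f f') :
    top (f' * S w) = 0 := by
  rw [hf.top_mul (ne_of_succ_eq hab) (isDivDiff_zero (hS.rename_eq hab h)), mul_zero, map_zero]

lemma IsFam.top_divDiff_mul (hS : IsFam S) (hab : (a : ℕ) + 1 = b)
    {f f' : MvPolynomial (Fin n) R} (hf : IsDivDiff a b f f') (v : Perm' n) :
    top (f' * S v) = if v b < v a then top (f * S (v * Equiv.swap a b)) else 0 := by
  split_ifs with h
  · rw [← hS.top_mul_S_of_ascent (w := v * Equiv.swap a b) hab (by simpa using h) hf, mul_assoc,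
      Equiv.swap_mul_self, mul_one]
  · exact hS.top_mul_S_of_ascent' hab
      (lt_of_le_of_ne (not_lt.1 h) fun e => ne_of_succ_eq hab (v.injective e)) hf

lemma IsFam.duality (hS : IsFam S) (v w : Perm' n) :
    top (S v * S (w0 n * w)) = if v = w then 1 else 0 := by
  induction v using descending_induction generalizing w with
  | base =>
    rw [hS.base, top_monomial_mul, hS.constantCoeff]
    refine if_congr ?_ rfl rfl
    constructor
    · intro h; rw [← w0_mul_w0_mul w, h, mul_one]
    · intro h; rw [← h]; exact w0_mul_w0_mul 1
  | step v a b hab h ih =>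
    rw [hS.top_divDiff_mul hab (hS.step hab h)]
    simp only [w0_mul_apply, Fin.rev_lt_rev]
    split_ifs with h1 h2 h2
    · rw [mul_assoc, ih, h2, if_pos rfl]
    · rw [mul_assoc, ih, if_neg (by simpa using h2)]
    · exact absurd (h2 ▸ h) h1
    · rfl

lemma IsFam.top_sym_mul (hS : IsFam S) {p : MvPolynomial (Fin n) R} (hp : p.IsSymmetric)
    (h0 : MvPolynomial.constantCoeff p = 0) (v : Perm' n) (f : MvPolynomial (Fin n) R) :
    top (p * f * S v) = 0 := by
  induction v using descending_induction generalizing f with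
  | base => rw [hS.base, mul_comm, top_monomial_mul, map_mul, h0, zero_mul]
  | step v a b hab h ih =>
    obtain ⟨f', hf⟩ := exists_isDivDiff a b f
    rw [← hS.top_mul_S_of_ascent hab h (hf.rename_mul (hp _)), ih]

lemma IsFam.top_mul_map_eq_zero (hS : IsFam S) (K : MvPolynomial (Fin n) R)
    {x : MvPolynomial (Fin n) ℤ} (hx : x ∈ symIdeal n) :
    top (K * MvPolynomial.map (Int.castRingHom R) x) = 0 := by
  induction hx using Submodule.span_induction generalizing K with
  | mem x hx =>
    obtain ⟨k, hk, rfl⟩ := hx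
    have h0 : MvPolynomial.constantCoeff (esymm (Fin n) R k) = 0 := by
      rw [esymm, map_sum]
      refine Finset.sum_eq_zero fun t ht => ?_
      rw [map_prod]
      obtain ⟨i, hi⟩ := Finset.card_pos.1 ((Finset.mem_powersetCard.1 ht).2.symm ▸ hk.1)
      exact Finset.prod_eq_zero hi (constantCoeff_X _ i)
    rw [map_esymm, mul_comm, ← mul_one (esymm _ _ _ * K), ← hS.one]
    exact hS.top_sym_mul (esymm_isSymmetric _ _ _) h0 _ _
  | zero => simp
  | add x y _ _ hx hy => rw [map_add, mul_add, map_add, hx, hy, add_zero]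
  | smul r x _ hx => rw [smul_eq_mul, RingHom.map_mul, ← mul_assoc, hx]

end Domain

open Classical in
/-- The signed sum over the Bruhat covers that involve position `k`. -/
def opX {n : ℕ} {R : Type*} [CommRing R] (k : Fin n) : Module.End R (Perm' n → R) where
  toFun F u := (∑ j, if Cov u k j then F (u * Equiv.swap k j) else 0) -
    ∑ i, if Cov u i k then F (u * Equiv.swap i k) else 0
  map_add' F G := by
    ext u
    simp only [Pi.add_apply, ← Finset.sum_filter, Finset.sum_add_distrib]
    ring
  map_smul' c F := by
    ext u
    simp only [Pi.smul_apply, ← Finset.sum_filter, ← Finset.smul_sum, smul_sub, RingHom.id_apply]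

open Classical in
lemma opX_apply {n : ℕ} {R : Type*} [CommRing R] (k : Fin n) (F : Perm' n → R) (u : Perm' n) :
    opX k F u = (∑ j, if Cov u k j then F (u * Equiv.swap k j) else 0) -
    ∑ i, if Cov u i k then F (u * Equiv.swap i k) else 0 := rfl

lemma cov_of_ascent {n : ℕ} {u : Perm' n} {a b : Fin n} (hab : (a : ℕ) + 1 = b) (h : u a < u b) :
    Cov u a b :=
  ⟨Fin.lt_def.2 (by omega), h, fun m h1 h2 => by rw [Fin.lt_def] at h1 h2; omega⟩

section

variable {n : ℕ} {R : Type*} [CommRing R] {a b : Fin n}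

lemma mul_swap_mul_swap_swap (u : Perm' n) (a b k j : Fin n) :
    u * Equiv.swap a b * Equiv.swap (Equiv.swap a b k) (Equiv.swap a b j) =
      u * Equiv.swap k j * Equiv.swap a b := by
  rw [Equiv.swap_apply_apply]; simp [mul_assoc]


lemma IsDivDiff.mul_X {f f' : MvPolynomial (Fin n) R} (hf : IsDivDiff a b f f') (hab : a ≠ b)
    (k : Fin n) : IsDivDiff a b (f * X k) (f' * X (Equiv.swap a b k) +
      C ((if k = a then 1 else 0) - (if k = b then 1 else 0)) * f) := by
  unfold IsDivDiff at *
  rw [map_mul, rename_X]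
  by_cases ha : k = a
  · subst ha
    simp only [Equiv.swap_apply_left, if_true, if_neg hab, sub_zero, C_1]
    linear_combination X b * hf
  · by_cases hb : k = b
    · subst hb
      simp only [Equiv.swap_apply_right, if_true, if_neg ha, zero_sub, C_neg, C_1]
      linear_combination X a * hf
    · rw [Equiv.swap_apply_of_ne_of_ne ha hb, if_neg ha, if_neg hb, sub_zero, C_0]
      linear_combination X k * hf

open Classical in
lemma opX_conj {u : Perm' n} (hab : (a : ℕ) + 1 = b) (h : u a < u b) (k : Fin n)
    (F : Perm' n → R) :
    opX (Equiv.swap a b k) (fun v => if v b < v a then F (v * Equiv.swap a b) else 0)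
        (u * Equiv.swap a b) +
      ((if k = a then 1 else 0) - (if k = b then 1 else 0)) * F (u * Equiv.swap a b) =
      opX k F u := by
  have hlt : ∀ (v : Perm' n), (v * Equiv.swap a b) b < (v * Equiv.swap a b) a ↔ v a < v b := by
    simp
  have hs : ∀ v : Perm' n, v * Equiv.swap a b * Equiv.swap a b = v := fun v => by
    rw [mul_assoc, Equiv.swap_mul_self, mul_one]
  have h1 : ∀ p q : Fin n,
      (if Cov (u * Equiv.swap a b) (Equiv.swap a b p) (Equiv.swap a b q) then
        (if (u * Equiv.swap p q * Equiv.swap a b) b < (u * Equiv.swap p q * Equiv.swap a b) a then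
          F (u * Equiv.swap p q * Equiv.swap a b * Equiv.swap a b) else 0) else 0) =
      (if Cov u p q then F (u * Equiv.swap p q) else 0) -
        if p = a ∧ q = b then F (u * Equiv.swap a b) else 0 := by
    intro p q
    simp only [hs, hlt, ← ite_and, cov_conj_iff u hab h p q]
    by_cases hpq : p = a ∧ q = b
    · obtain ⟨rfl, rfl⟩ := hpq
      simp [cov_of_ascent hab h]
    · simp [hpq]
  rw [opX_apply, opX_apply, ← Equiv.sum_comp (Equiv.swap a b),
    ← Equiv.sum_comp (Equiv.swap a b) (fun i => if Cov _ i _ then _ else _)]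
  simp only [mul_swap_mul_swap_swap, h1, Finset.sum_sub_distrib]
  have h2 : (∑ j, if k = a ∧ j = b then F (u * Equiv.swap a b) else 0) =
      (if k = a then 1 else 0) * F (u * Equiv.swap a b) := by
    by_cases hk : k = a <;> simp [hk]
  have h3 : (∑ i, if i = a ∧ k = b then F (u * Equiv.swap a b) else 0) =
      (if k = b then 1 else 0) * F (u * Equiv.swap a b) := by
    by_cases hk : k = b <;> simp [hk]
  rw [h2, h3]
  ring

/-- Monk's rule for the functional `top`. -/
lemma IsFam.top_mul_X [IsDomain R] [CharZero R] {S : Perm' n → MvPolynomial (Fin n) R}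
    (hS : IsFam S) (u : Perm' n) (f : MvPolynomial (Fin n) R) (k : Fin n) :
    top (f * X k * S u) = opX k (fun v => top (f * S v)) u := by
  induction u using descending_induction generalizing f k with
  | base =>
    rw [hS.base, mul_comm, top_monomial_mul, map_mul, constantCoeff_X, mul_zero, opX_apply]
    have : ∀ i j, ¬ Cov (w0 n) i j := fun i j h => w0_ascent_false h.1 h.2.1
    simp [this]
  | step u a b hab h ih =>
    obtain ⟨f', hf⟩ := exists_isDivDiff a b f
    have hne := ne_of_succ_eq hab
    rw [← hS.top_mul_S_of_ascent hab h (hf.mul_X hne k), add_mul, map_add, ih, mul_assoc,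
      ← smul_eq_C_mul, map_smul, smul_eq_mul, ← opX_conj hab h k]
    simp only [hS.top_divDiff_mul hab hf]

end

section Operators

variable {n : ℕ} {R : Type*} [CommRing R]

open Classical in
/-- The sum over the edges labeled `(k, b)` in the labeled Bruhat order. -/
def opA (k b : ℕ) : Module.End R (Perm' n → R) where
  toFun F u := ∑ i : Fin n, ∑ j : Fin n,
    if Cov u i j ∧ (i : ℕ) ≤ k ∧ k < (j : ℕ) ∧ (u i : ℕ) = b then F (u * Equiv.swap i j) else 0
  map_add' F G := by
    ext u
    simp only [Pi.add_apply, ← Finset.sum_filter, Finset.sum_add_distrib]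
  map_smul' c F := by
    ext u
    simp only [Pi.smul_apply, ← Finset.sum_filter, ← Finset.smul_sum, RingHom.id_apply]

open Classical in
/-- The part of `opX k` in which the smaller exchanged value is at least `b`. -/
def opY (k : Fin n) (b : ℕ) : Module.End R (Perm' n → R) where
  toFun F u := (∑ j, if Cov u k j ∧ b ≤ (u k : ℕ) then F (u * Equiv.swap k j) else 0) -
    ∑ i, if Cov u i k ∧ b ≤ (u i : ℕ) then F (u * Equiv.swap i k) else 0
  map_add' F G := by
    ext u
    simp only [Pi.add_apply, ← Finset.sum_filter, Finset.sum_add_distrib]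
    ring
  map_smul' c F := by
    ext u
    simp only [Pi.smul_apply, ← Finset.sum_filter, ← Finset.smul_sum, smul_sub, RingHom.id_apply]

open Classical in
lemma opA_apply (k b : ℕ) (F : Perm' n → R) (u : Perm' n) :
    opA k b F u = ∑ i : Fin n, ∑ j : Fin n,
      if Cov u i j ∧ (i : ℕ) ≤ k ∧ k < (j : ℕ) ∧ (u i : ℕ) = b then F (u * Equiv.swap i j)
      else 0 := rfl

open Classical in
lemma opA_apply_of_eq {k b : ℕ} {u : Perm' n} {i : Fin n} (hi : (u i : ℕ) = b)
    (F : Perm' n → R) : opA k b F u =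
      ∑ j : Fin n, if Cov u i j ∧ (i : ℕ) ≤ k ∧ k < (j : ℕ) then F (u * Equiv.swap i j)
      else 0 := by
  rw [opA_apply, Finset.sum_eq_single i]
  · simp [hi]
  · intro i' _ h
    refine Finset.sum_eq_zero fun j _ => if_neg fun hc => h ?_
    exact u.injective (Fin.ext (hc.2.2.2.trans hi.symm))
  · simp

lemma opA_eq_zero_of_lt {k b : ℕ} {u : Perm' n} {i : Fin n} (hi : (u i : ℕ) = b) (hk : k < i)
    (F : Perm' n → R) : opA k b F u = 0 := by
  classical
  rw [opA_apply_of_eq hi]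
  exact Finset.sum_eq_zero fun j _ => if_neg fun hc => absurd hc.2.1 (not_le.2 hk)

open Classical in
lemma opY_apply (k : Fin n) (b : ℕ) (F : Perm' n → R) (u : Perm' n) :
    opY k b F u = (∑ j, if Cov u k j ∧ b ≤ (u k : ℕ) then F (u * Equiv.swap k j) else 0) -
      ∑ i, if Cov u i k ∧ b ≤ (u i : ℕ) then F (u * Equiv.swap i k) else 0 := rfl

lemma opY_zero (k : Fin n) : (opY k 0 : Module.End R (Perm' n → R)) = opX k := by
  classical
  refine LinearMap.ext fun F => funext fun u => ?_
  simp [opY_apply, opX_apply]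

lemma opY_self (k : Fin n) : (opY k n : Module.End R (Perm' n → R)) = 0 := by
  classical
  refine LinearMap.ext fun F => funext fun u => ?_
  have : ∀ m : Fin n, ¬ n ≤ (m : ℕ) := fun m => not_le.2 m.2
  simp [opY_apply, this]

lemma opA_of_le {k : ℕ} (hk : n ≤ k + 1) (b : ℕ) :
    (opA k b : Module.End R (Perm' n → R)) = 0 := by
  classical
  refine LinearMap.ext fun F => funext fun u => ?_
  rw [opA_apply]
  refine Finset.sum_eq_zero fun i _ => Finset.sum_eq_zero fun j _ => if_neg fun h => ?_
  have := j.2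
  omega

lemma opY_sub_opY (k : Fin n) {k' : ℕ} (hk : k' + 1 = k) (b : ℕ) :
    (opY k b - opY k (b + 1) : Module.End R (Perm' n → R)) = opA k b - opA k' b := by
  classical
  refine LinearMap.ext fun F => funext fun u => ?_
  simp only [LinearMap.sub_apply, Pi.sub_apply, opY_apply, opA_apply]
  rw [sub_sub_sub_comm, ← Finset.sum_sub_distrib, ← Finset.sum_sub_distrib,
    ← Finset.sum_sub_distrib]
  simp only [← Finset.sum_sub_distrib]
  have key : ∀ i j : Fin n,
      ((if Cov u i j ∧ (i : ℕ) ≤ k ∧ (k : ℕ) < j ∧ (u i : ℕ) = b then F (u * Equiv.swap i j)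
        else 0) - if Cov u i j ∧ (i : ℕ) ≤ k' ∧ k' < (j : ℕ) ∧ (u i : ℕ) = b then
          F (u * Equiv.swap i j) else 0) =
      (if i = k then (if Cov u k j ∧ (u k : ℕ) = b then F (u * Equiv.swap k j) else 0) else 0) -
      if j = k then (if Cov u i k ∧ (u i : ℕ) = b then F (u * Equiv.swap i k) else 0) else 0 := by
    intro i j
    by_cases h : Cov u i j ∧ (u i : ℕ) = b
    · obtain ⟨h1, h2⟩ := h
      have h3 := Fin.lt_def.1 h1.1
      by_cases hi : i = k
      · subst hi
        have hj : j ≠ i := h1.1.ne'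
        rw [if_pos ⟨h1, le_rfl, h3, h2⟩, if_neg (by omega), if_pos rfl, if_pos ⟨h1, h2⟩, if_neg hj]
      · by_cases hj : j = k
        · subst hj
          rw [if_neg (by omega), if_pos ⟨h1, by omega, by omega, h2⟩, if_neg hi, if_pos rfl,
            if_pos ⟨h1, h2⟩]
        · rw [if_neg hi, if_neg hj, sub_zero, sub_eq_zero]
          refine if_congr ?_ rfl rfl
          have : (i : ℕ) ≠ k := fun e => hi (Fin.ext e)
          have : (j : ℕ) ≠ k := fun e => hj (Fin.ext e)
          constructor <;> rintro ⟨h, a, b, c⟩ <;> exact ⟨h, by omega, by omega, c⟩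
    · rw [if_neg (by tauto), if_neg (by tauto)]
      by_cases hi : i = k
      · subst hi
        rw [if_pos rfl, if_neg h]
        by_cases hj : j = i
        · subst hj; rw [if_pos rfl, if_neg h]
        · rw [if_neg hj]
      · rw [if_neg hi]
        by_cases hj : j = k
        · subst hj; rw [if_pos rfl, if_neg h]
        · rw [if_neg hj]
  have hdiff : ∀ (p : Prop) (m : ℕ) (x : R),
      ((if p ∧ b ≤ m then x else 0) - if p ∧ b + 1 ≤ m then x else 0) =
        if p ∧ m = b then x else 0 := by
    intro p m x
    by_cases hp : p
    · simp only [hp, true_and]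
      rcases lt_trichotomy m b with h | h | h
      · rw [if_neg (by omega), if_neg (by omega), if_neg (by omega), sub_zero]
      · rw [if_pos (by omega), if_neg (by omega), if_pos (by omega), sub_zero]
      · rw [if_pos (by omega), if_pos (by omega), if_neg (by omega), sub_self]
    · simp [hp]
  simp only [key, hdiff, Finset.sum_sub_distrib]
  congr 1
  · rw [Finset.sum_comm]; simp
  · simp

lemma opY_mul_opA (k : Fin n) {k' : ℕ} (hk : k' + 1 = k) (b : ℕ) :
    (opY k b * opA k b : Module.End R (Perm' n → R)) = opA k' b * opY k (b + 1) := by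
  classical
  refine LinearMap.ext fun F => funext fun u => ?_
  simp only [Module.End.mul_apply]
  by_cases hb : b < n
  swap
  · have : ∀ (k : ℕ) (G : Perm' n → R) (v : Perm' n), opA k b G v = 0 := fun k G v => by
      rw [opA_apply]
      refine Finset.sum_eq_zero fun i _ => Finset.sum_eq_zero fun j _ => if_neg fun h => ?_
      have := (v i).2
      omega
    simp [opY_apply, this]
  obtain ⟨i, hi⟩ : ∃ i, (u i : ℕ) = b := ⟨u⁻¹ ⟨b, hb⟩, by simp⟩
  have hval : ∀ m, (u m : ℕ) = b → m = i := fun m h => u.injective (Fin.ext (h.trans hi.symm))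
  rcases le_or_gt k i with hki | hik
  · rw [opA_eq_zero_of_lt hi (by rw [Fin.le_def] at hki; omega), opY_apply]
    refine sub_eq_zero.2 ((Finset.sum_eq_zero fun l _ => ?_).trans
      (Finset.sum_eq_zero fun m _ => ?_).symm)
    · rw [ite_eq_right_iff]
      rintro ⟨h, hbk⟩
      rcases hki.eq_or_lt with rfl | hki
      · refine opA_eq_zero_of_lt (i := l) ?_ h.1 F
        rw [mul_swap_apply, if_neg h.1.ne', if_pos rfl, hi]
      · refine opA_eq_zero_of_lt (i := i) ?_ hki F
        have : i ≠ l := by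
          rintro rfl
          have := Fin.lt_def.1 h.2.1
          omega
        rw [mul_swap_apply, if_neg hki.ne', if_neg this, hi]
    · rw [ite_eq_right_iff]
      rintro ⟨h, hbm⟩
      have hlt := Fin.lt_def.1 h.2.1
      rcases hki.eq_or_lt with rfl | hki
      · omega
      · refine opA_eq_zero_of_lt (i := i) ?_ hki F
        rw [mul_swap_apply, if_neg (h.1.trans hki).ne', if_neg hki.ne', hi]
  · have hik' := Fin.lt_def.1 hik
    have hsub : ∀ m, b + 1 ≤ (u m : ℕ) ↔ u i < u m := fun m => by rw [Fin.lt_def, hi]; omega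
    set p : Fin n → Fin n → R := fun l j => if (u i < u k ∧ Cov u k l ∧
      Cov (u * Equiv.swap k l) i j) ∧ k < j then F (u * Equiv.swap k l * Equiv.swap i j)
      else 0 with hp
    set q : Fin n → Fin n → R := fun m j => if m = i then (if (Cov u i k ∧
      Cov (u * Equiv.swap i k) k j) then F (u * Equiv.swap i k * Equiv.swap k j) else 0) else
      (if (u i < u m ∧ Cov u m k ∧ Cov (u * Equiv.swap m k) i j) ∧ k < j then
        F (u * Equiv.swap m k * Equiv.swap i j) else 0) with hq
    set p' : Fin n → Fin n → R := fun l j => if (u i < u k ∧ Cov u i j ∧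
      Cov (u * Equiv.swap i j) k l) ∧ k < j ∧ j ≠ l then F (u * Equiv.swap i j * Equiv.swap k l)
      else 0 with hp'
    set q' : Fin n → Fin n → R := fun m j => if m = i then (if (Cov u i j ∧
      Cov (u * Equiv.swap i j) i k) ∧ k < j then F (u * Equiv.swap i j * Equiv.swap i k)
      else 0) else
      (if (u i < u m ∧ Cov u i j ∧ Cov (u * Equiv.swap i j) m k) ∧ k < j then
        F (u * Equiv.swap i j * Equiv.swap m k) else 0) with hq'
    have hL : opY k b (opA k b F) u = (∑ l, ∑ j, p l j) - ∑ m, ∑ j, q m j := by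
      rw [opY_apply]
      congr 1
      · refine Finset.sum_congr rfl fun l _ => ?_
        by_cases h : Cov u k l ∧ u i < u k
        · have hil : i ≠ l := (hik.trans h.1.1).ne
          rw [if_pos ⟨h.1, by have := (hsub k).2 h.2; omega⟩,
            opA_apply_of_eq (i := i) (by rw [mul_swap_apply, if_neg hik.ne, if_neg hil, hi])]
          refine Finset.sum_congr rfl fun j _ => if_congr ?_ rfl rfl
          simp only [h, true_and, Fin.lt_def, and_congr_right_iff, and_iff_right_iff_imp]
          omega
        · have hne : u i ≠ u k := fun e => hik.ne (u.injective e)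
          rw [if_neg fun hc => h ⟨hc.1, lt_of_le_of_ne (Fin.le_def.2 (by omega)) hne⟩]
          exact (Finset.sum_eq_zero fun j _ => if_neg (by tauto)).symm
      · refine Finset.sum_congr rfl fun m _ => ?_
        by_cases hm : m = i
        · subst hm
          simp only [hq, if_true]
          by_cases h : Cov u m k
          · rw [if_pos ⟨h, hi.ge⟩, opA_apply_of_eq (i := k)
              (by rw [mul_swap_apply, if_neg hik.ne', if_pos rfl, hi])]
            refine Finset.sum_congr rfl fun j _ => if_congr ?_ rfl rfl
            simp only [h, true_and, and_iff_left_iff_imp]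
            exact fun hc => ⟨le_rfl, hc.1⟩
          · simp [h]
        · simp only [hq, if_neg hm]
          by_cases h : Cov u m k ∧ u i < u m
          · rw [if_pos ⟨h.1, by have := (hsub m).2 h.2; omega⟩, opA_apply_of_eq (i := i)
              (by rw [mul_swap_apply, if_neg (Ne.symm hm), if_neg hik.ne, hi])]
            refine Finset.sum_congr rfl fun j _ => if_congr ?_ rfl rfl
            simp only [h, true_and, Fin.lt_def, and_congr_right_iff, and_iff_right_iff_imp]
            omega
          · have hne : u i ≠ u m := fun e => hm (u.injective e).symm
            rw [if_neg fun hc => h ⟨hc.1, lt_of_le_of_ne (Fin.le_def.2 (by omega)) hne⟩]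
            exact (Finset.sum_eq_zero fun j _ => if_neg (by tauto)).symm
    have hR : opA k' b (opY k (b + 1) F) u = (∑ l, ∑ j, p' l j) - ∑ m, ∑ j, q' m j := by
      rw [opA_apply_of_eq hi, Finset.sum_comm, Finset.sum_comm (f := q'), ← Finset.sum_sub_distrib]
      refine Finset.sum_congr rfl fun j _ => ?_
      have hvi : (u * Equiv.swap i j) j = u i := by simp
      have hvj : (u * Equiv.swap i j) i = u j := by simp
      have hv : ∀ m, m ≠ i → m ≠ j → (u * Equiv.swap i j) m = u m := fun m h1 h2 => by
        rw [mul_swap_apply, if_neg h1, if_neg h2]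
      rcases lt_trichotomy j k with hjk | rfl | hjk
      · have h1 := Fin.lt_def.1 hjk
        have h2 : ¬ k < j := hjk.asymm
        simp only [hp', hq', h2, and_false, false_and, if_false, Finset.sum_const_zero, sub_zero,
          ite_self, ite_eq_right_iff]
        omega
      · simp only [hp', hq', lt_irrefl, and_false, false_and, if_false, Finset.sum_const_zero,
          sub_zero, ite_self, ite_eq_right_iff]
        rintro -
        rw [opY_apply]
        refine sub_eq_zero.2 ((Finset.sum_eq_zero fun l _ => if_neg ?_).trans
          (Finset.sum_eq_zero fun m _ => if_neg ?_).symm)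
        · rw [hvi]; omega
        · rintro ⟨h1, h2⟩
          have := Fin.lt_def.1 h1.2.1
          rw [hvi] at this
          omega
      · have hjk' := Fin.lt_def.1 hjk
        by_cases h : Cov u i j
        · rw [if_pos ⟨h, by omega, by omega⟩, opY_apply]
          congr 1
          · refine Finset.sum_congr rfl fun l _ => if_congr ?_ rfl rfl
            rw [hv k hik.ne' hjk.ne, hsub]
            constructor
            · rintro ⟨h1, h2⟩
              refine ⟨⟨h2, h, h1⟩, hjk, ?_⟩
              rintro rfl
              have := h1.2.1
              rw [hvi, hv k hik.ne' hjk.ne] at this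
              exact this.asymm h2
            · rintro ⟨⟨h1, h2, h3⟩, -, -⟩
              exact ⟨h3, h1⟩
          · refine Finset.sum_congr rfl fun m _ => ?_
            by_cases hm : m = i
            · subst hm
              simp only [hq', if_true]
              refine if_congr ?_ rfl rfl
              rw [hvj, hsub]
              have := h.2.1
              tauto
            · simp only [hq', if_neg hm]
              refine if_congr ?_ rfl rfl
              by_cases hmk : m < k
              · rw [hv m hm (hmk.trans hjk).ne, hsub]
                tauto
              · have : ¬ Cov (u * Equiv.swap i j) m k := fun hc => hmk hc.1
                tauto
        · rw [if_neg (by tauto)]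
          simp [hp', hq', h]
    set d : Fin n → R := fun l => if (u i < u k ∧ Cov u k l ∧ Cov (u * Equiv.swap k l) i l) then
      F (u * Equiv.swap k l * Equiv.swap i l) else 0 with hd
    have h1 : ∀ l j, p l j = p' l j + if j = l then d l else 0 := by
      intro l j
      simp only [hp, hp', hd]
      by_cases hl : k < l
      · by_cases hj : k < j
        · by_cases hjl : j = l
          · subst hjl
            simp [hj]
          · simp only [hj, hjl, and_true, ne_eq, not_false_eq_true, if_false, add_zero]
            refine if_congr (cov_disjoint_right u hik hj hl hjl) (congrArg F ?_) rfl
            ext x; simp only [mul_swap_apply]; grind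
        · have : j ≠ l := by rintro rfl; exact hj hl
          simp [hj, this]
      · have h3 : ∀ v : Perm' n, ¬ Cov v k l := fun v hc => hl hc.1
        simp [h3]
    have h2 : ∀ m j, q m j = q' m j + if m = i then d j else 0 := by
      intro m j
      simp only [hq, hq', hd]
      by_cases hm : m = i
      · subst hm
        simp only [if_true]
        by_cases hj : k < j
        · have h1 := cov_triple u hik hj
          have h2 := cov_triple_disjoint u hik hj
          have e1 : u * Equiv.swap m k * Equiv.swap k j =
              u * Equiv.swap m j * Equiv.swap m k := by
            ext x; simp only [mul_swap_apply]; grind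
          have e2 : u * Equiv.swap m k * Equiv.swap k j =
              u * Equiv.swap k j * Equiv.swap m j := by
            ext x; simp only [mul_swap_apply]; grind
          rw [← e1, ← e2]
          by_cases hA : u m < u k ∧ Cov u k j ∧ Cov (u * Equiv.swap k j) m j
          · rw [if_pos (h1.2 (Or.inl hA)), if_neg fun hc => h2 hA.2.1 hc.1.2, if_pos hA, zero_add]
          · rw [if_neg hA, add_zero]
            refine if_congr (h1.trans ?_) rfl rfl
            tauto
        · have h3 : ∀ v : Perm' n, ¬ Cov v k j := fun v hc => hj hc.1
          simp [hj, h3]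
      · simp only [if_neg hm, add_zero]
        by_cases hj : k < j
        · by_cases hmk : m < k
          · simp only [hj, and_true]
            refine if_congr (cov_disjoint_left u hik hj hmk hm) (congrArg F ?_) rfl
            ext x; simp only [mul_swap_apply]; grind
          · have h3 : ∀ v : Perm' n, ¬ Cov v m k := fun v hc => hmk hc.1
            simp [h3]
        · simp [hj]
    rw [hL, hR]
    simp only [h1, h2, Finset.sum_add_distrib]
    simp

/-- The generating operator of increasing chains all of whose labels start with `k` and end
with an element of `{0, …, N - 1}`. -/
def opH (N k : ℕ) (t : R) : Module.End R (Perm' n → R) :=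
  ((List.range N).map fun b => 1 + t • opA k b).prod

lemma one_sub_opY_mul_opH (k : Fin n) {k' : ℕ} (hk : k' + 1 = k) (t : R) (N : ℕ) :
    (1 - t • opY k 0) * opH N k t = opH N k' t * (1 - t • opY k N) := by
  induction N with
  | zero => simp [opH]
  | succ N ih =>
    have key : (1 - t • opY k N) * (1 + t • opA k N) =
        ((1 + t • opA k' N) * (1 - t • opY k (N + 1)) : Module.End R (Perm' n → R)) := by
      have h1 := opY_mul_opA (R := R) k hk N
      have h2 := opY_sub_opY (R := R) k hk N
      simp only [mul_add, add_mul, mul_sub, sub_mul, mul_one, one_mul, smul_mul_smul_comm, h1]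
      have h3 := congrArg (t • ·) h2
      simp only [smul_sub] at h3
      rw [sub_eq_sub_iff_add_eq_add] at h3
      rw [← sub_eq_zero] at h3 ⊢
      rw [← neg_eq_zero, ← h3]
      abel
    have hs : ∀ k : ℕ, (opH (N + 1) k t : Module.End R (Perm' n → R)) =
        opH N k t * (1 + t • opA k N) := fun k => by
      simp [opH, List.range_succ]
    rw [hs, hs, ← mul_assoc, ih, mul_assoc, key, mul_assoc]

lemma one_sub_opX_mul_opH (k : Fin n) {k' : ℕ} (hk : k' + 1 = k) (t : R) :
    (1 - t • opX k) * opH n k t = opH n k' t := by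
  rw [← opY_zero, one_sub_opY_mul_opH k hk, opY_self, smul_zero, sub_zero, mul_one]

lemma opH_of_le {k : ℕ} (hk : n ≤ k + 1) (t : R) :
    (opH n k t : Module.End R (Perm' n → R)) = 1 := by
  simp [opH, opA_of_le hk]

variable [IsDomain R] [CharZero R] {S : Perm' n → MvPolynomial (Fin n) R}

lemma IsFam.opH_apply (hS : IsFam S) (k : ℕ) (t : R) (f : MvPolynomial (Fin n) R) :
    opH n k t (fun u => top (f * S u)) =
      fun u => top (f * (∏ i with k < (i : Fin n).val, (1 - C t * X i)) * S u) := by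
  induction hd : n - 1 - k generalizing k with
  | zero =>
    rw [opH_of_le (by omega), Finset.filter_false_of_mem fun i _ => by omega, Finset.prod_empty,
      mul_one, Module.End.one_apply]
  | succ d ih =>
    have hk : k + 1 < n := by omega
    have hfil : (Finset.univ.filter fun i : Fin n => k < (i : ℕ)) =
        insert ⟨k + 1, hk⟩ (Finset.univ.filter fun i : Fin n => k + 1 < (i : ℕ)) := by
      ext i
      simp only [Finset.mem_filter, Finset.mem_univ, true_and, Finset.mem_insert, Fin.ext_iff]
      omega
    rw [← one_sub_opX_mul_opH ⟨k + 1, hk⟩ rfl, Module.End.mul_apply, ih (k + 1) (by omega), hfil,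
      Finset.prod_insert (by simp)]
    funext u
    simp only [LinearMap.sub_apply, Module.End.one_apply, LinearMap.smul_apply, Pi.sub_apply,
      Pi.smul_apply]
    rw [← hS.top_mul_X, ← map_smul, ← map_sub, smul_eq_C_mul]
    congr 1
    ring

lemma IsFam.prod_opH_apply (hS : IsFam S) (t : ℕ → R) (L : List ℕ)
    (f : MvPolynomial (Fin n) R) :
    (L.map fun k => opH n k (t k)).prod (fun u => top (f * S u)) =
      fun u => top (f * (L.map fun k => ∏ i with k < (i : Fin n).val,
        (1 - C (t k) * X i)).prod * S u) := by
  induction L with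
  | nil => simp
  | cons k L ih =>
    rw [List.map_cons, List.prod_cons, Module.End.mul_apply, ih, hS.opH_apply, List.map_cons,
      List.prod_cons]
    funext u
    congr 2
    ring

end Operators

section Paths

variable {n : ℕ}

/-- Saturated chains as lists of labels together with the permutation they lead to. -/
def IsPath : List ((ℕ × ℕ) × Perm' n) → Perm' n → Perm' n → Prop
  | [], u, w => u = w
  | e :: p, u, w => IsLabeledCover u e.2 e.1.1 e.1.2 ∧ IsPath p e.2 w

open Classical in
/-- The chains from `u` to `w` whose labels form a sublist of `L`. -/
def paths : List (ℕ × ℕ) → Perm' n → Perm' n → Finset (List ((ℕ × ℕ) × Perm' n))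
  | [], u, w => if u = w then {[]} else ∅
  | l :: L, u, w => paths L u w ∪
      (Finset.univ.filter fun v => IsLabeledCover u v l.1 l.2).biUnion fun v =>
        (paths L v w).image (List.cons (l, v))

lemma mem_paths {L : List (ℕ × ℕ)} {u w : Perm' n} {p : List ((ℕ × ℕ) × Perm' n)} :
    p ∈ paths L u w ↔ IsPath p u w ∧ (p.map Prod.fst).Sublist L := by
  induction L generalizing u p with
  | nil =>
    rw [List.sublist_nil, List.map_eq_nil_iff, paths]
    constructor
    · intro h
      split_ifs at h with huw
      · rw [Finset.mem_singleton] at h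
        subst h; exact ⟨huw, rfl⟩
      · simp at h
    · rintro ⟨h, rfl⟩
      rw [if_pos (show u = w from h), Finset.mem_singleton]
  | cons l L ih =>
    simp only [paths, Finset.mem_union, Finset.mem_biUnion, Finset.mem_filter, Finset.mem_univ,
      true_and, Finset.mem_image, ih, List.sublist_cons_iff]
    constructor
    · rintro (⟨h1, h2⟩ | ⟨v, hv, q, ⟨h1, h2⟩, rfl⟩)
      · exact ⟨h1, Or.inl h2⟩
      · exact ⟨⟨hv, h1⟩, Or.inr ⟨_, rfl, h2⟩⟩
    · rintro ⟨h1, h2 | ⟨r, h2, h3⟩⟩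
      · exact Or.inl ⟨h1, h2⟩
      · obtain _ | ⟨⟨l', v⟩, q⟩ := p
        · simp at h2
        · simp only [List.map_cons, List.cons.injEq] at h2
          obtain ⟨rfl, rfl⟩ := h2
          exact Or.inr ⟨v, h1.1, q, ⟨h1.2, h3⟩, rfl⟩

open Classical in
lemma opA_eq_sum {R : Type*} [CommRing R] (k b : ℕ) (F : Perm' n → R) (u : Perm' n) :
    opA k b F u = ∑ v with IsLabeledCover u v k b, F v := by
  rw [opA_apply, ← Fintype.sum_prod_type', ← Finset.sum_filter]
  refine Finset.sum_bij (fun e _ => u * Equiv.swap e.1 e.2) ?_ ?_ ?_ fun _ _ => rfl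
  · rintro ⟨i, j⟩ h
    simp only [Finset.mem_filter, Finset.mem_univ, true_and] at h ⊢
    exact ⟨i, j, h.1.1, h.1.2.1, h.1.2.2, rfl, h.2.1, h.2.2.1, h.2.2.2.symm⟩
  · rintro ⟨i, j⟩ h ⟨i', j'⟩ h' e
    simp only [Finset.mem_filter, Finset.mem_univ, true_and] at h h' e
    have hi : i = i' := u.injective (Fin.ext (h.2.2.2.trans h'.2.2.2.symm))
    subst hi
    have := congrArg (fun σ : Perm' n => σ i) (mul_left_cancel e)
    simp only [Equiv.swap_apply_left] at this
    rw [this]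
  · intro v h
    simp only [Finset.mem_filter, Finset.mem_univ, true_and] at h
    obtain ⟨i, j, h1, h2, h3, h4, h5, h6, h7⟩ := h
    exact ⟨(i, j), by simpa using ⟨⟨h1, h2, h3⟩, h5, h6, h7.symm⟩, h4.symm⟩

lemma prod_opA_apply {R : Type*} [CommRing R] (t : ℕ → R) {L : List (ℕ × ℕ)} (hL : L.Nodup)
    (u w : Perm' n) :
    (L.map fun l => (1 + t l.1 • opA l.1 l.2 : Module.End R (Perm' n → R))).prod
        (fun v => if v = w then 1 else 0) u =
      ∑ p ∈ paths L u w, (p.map fun e => t e.1.1).prod := by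
  classical
  induction L generalizing u with
  | nil =>
    rw [List.map_nil, List.prod_nil, Module.End.one_apply, paths]
    split_ifs <;> simp
  | cons l L ih =>
    rw [List.nodup_cons] at hL
    rw [List.map_cons, List.prod_cons, Module.End.mul_apply, LinearMap.add_apply,
      LinearMap.smul_apply, Module.End.one_apply, Pi.add_apply, Pi.smul_apply, opA_eq_sum, paths,
      Finset.sum_union, Finset.sum_biUnion, ih hL.2]
    · congr 1
      rw [Finset.smul_sum]
      refine Finset.sum_congr rfl fun v _ => ?_
      rw [ih hL.2, Finset.sum_image (List.cons_injective.injOn), Finset.smul_sum]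
      simp
    · intro v _ v' _ hv
      rw [Function.onFun, Finset.disjoint_left]
      simp only [Finset.mem_image]
      rintro _ ⟨p, _, rfl⟩ ⟨q, _, h⟩
      simp only [List.cons.injEq, Prod.mk.injEq, true_and] at h
      exact hv h.1.symm
    · rw [Finset.disjoint_left]
      intro p hp hp'
      simp only [Finset.mem_biUnion, Finset.mem_image] at hp'
      obtain ⟨v, _, q, _, rfl⟩ := hp'
      exact hL.1 ((mem_paths.1 hp).2.subset (by simp))

/-- All labels in lexicographic order. -/
def labels (n : ℕ) : List (ℕ × ℕ) := List.range n ×ˢ List.range n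

lemma pairwise_labels (n : ℕ) : (labels n).Pairwise lexLt := by
  unfold labels
  rw [show List.range n ×ˢ List.range n =
    (List.range n).flatMap fun k => (List.range n).map (Prod.mk k) from rfl, List.pairwise_flatMap]
  refine ⟨fun k _ => ?_, ?_⟩
  · rw [List.pairwise_map]
    exact List.pairwise_lt_range.imp fun h => Or.inr ⟨rfl, h⟩
  · refine List.pairwise_lt_range.imp fun h x hx y hy => ?_
    simp only [List.mem_map] at hx hy
    obtain ⟨_, _, rfl⟩ := hx
    obtain ⟨_, _, rfl⟩ := hy
    exact Or.inl h

lemma nodup_labels (n : ℕ) : (labels n).Nodup :=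
  (pairwise_labels n).imp fun {a b} h e => by
    subst e
    rcases h with h | h
    · exact lt_irrefl _ h
    · exact lt_irrefl _ h.2

lemma prod_labels {M : Type*} [Monoid M] (n : ℕ) (f : ℕ → ℕ → M) :
    ((labels n).map fun l => f l.1 l.2).prod =
      ((List.range n).map fun k => ((List.range n).map (f k)).prod).prod := by
  rw [labels, show List.range n ×ˢ List.range n =
    (List.range n).flatMap fun k => (List.range n).map (Prod.mk k) from rfl]
  have : ∀ L L' : List ℕ, ((L.flatMap fun k => L'.map (Prod.mk k)).map fun l => f l.1 l.2).prod =
      (L.map fun k => (L'.map (f k)).prod).prod := fun L L' => by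
    induction L with
    | nil => simp
    | cons a L ih => simp [ih, Function.comp_def]
  exact this _ _

lemma sublist_labels_iff {l : List (ℕ × ℕ)} (hl : ∀ e ∈ l, e ∈ labels n) :
    l.Sublist (labels n) ↔ l.Pairwise lexLt := by
  refine ⟨fun h => (pairwise_labels n).sublist h, fun h => ?_⟩
  have : Std.Antisymm lexLt := ⟨fun a b h1 h2 => by unfold lexLt at h1 h2; omega⟩
  refine List.sublist_of_subperm_of_pairwise (List.Nodup.subperm (h.imp ?_) hl) h
    (pairwise_labels n)
  rintro a b h rfl
  unfold lexLt at h
  omega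

lemma IsLabeledCover.mem_labels {u v : Perm' n} {l : ℕ × ℕ} (h : IsLabeledCover u v l.1 l.2) :
    l ∈ labels n := by
  obtain ⟨i, j, -, -, -, -, -, h6, h7⟩ := h
  obtain ⟨k, b⟩ := l
  simp only at h6 h7
  exact List.pair_mem_product.2 ⟨List.mem_range.2 (by omega), List.mem_range.2 (by omega)⟩

lemma IsPath.mem_labels {p : List ((ℕ × ℕ) × Perm' n)} {u w : Perm' n} (h : IsPath p u w) :
    ∀ e ∈ p.map Prod.fst, e ∈ labels n := by
  induction p generalizing u with
  | nil => simp
  | cons e p ih =>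
    simp only [List.map_cons, List.forall_mem_cons]
    exact ⟨h.1.mem_labels, ih h.2⟩

lemma isPath_ofFn {m : ℕ} (g : Fin m → (ℕ × ℕ) × Perm' n) (u w : Perm' n) :
    IsPath (List.ofFn g) u w ↔
      (∀ i : Fin m, IsLabeledCover ((Fin.cons u fun i => (g i).2 : Fin (m + 1) → Perm' n)
        i.castSucc) (g i).2 (g i).1.1 (g i).1.2) ∧
      (Fin.cons u fun i => (g i).2 : Fin (m + 1) → Perm' n) (Fin.last m) = w := by
  induction m generalizing u with
  | zero => simp [IsPath]
  | succ m ih =>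
    rw [List.ofFn_succ, IsPath, ih, Fin.forall_fin_succ, and_assoc]
    have key : ∀ j : Fin (m + 1), (Fin.cons (g 0).2 fun i : Fin m => (g i.succ).2 :
        Fin (m + 1) → Perm' n) j = (g j).2 := Fin.cases rfl fun _ => rfl
    simp only [key, ← Fin.succ_castSucc, ← Fin.succ_last, Fin.cons_succ]
    rfl

/-- The type of a chain. -/
def pathType (p : List ((ℕ × ℕ) × Perm' n)) : Fin n →₀ ℕ :=
  Finsupp.equivFunOnFinite.symm fun k => (p.map fun e => if e.1.1 = (k : ℕ) then 1 else 0).sum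

lemma pathType_apply (p : List ((ℕ × ℕ) × Perm' n)) (k : Fin n) :
    pathType p k = (p.map fun e => if e.1.1 = (k : ℕ) then 1 else 0).sum := rfl

/-- The list of labels and permutations of a chain. -/
def LabeledChain.toList {m : ℕ} {u w : Perm' n} (γ : LabeledChain n m u w) :
    List ((ℕ × ℕ) × Perm' n) :=
  List.ofFn fun i => (γ.lab i, γ.c i.succ)

lemma LabeledChain.cons_c {m : ℕ} {u w : Perm' n} (γ : LabeledChain n m u w) :
    (Fin.cons u fun i => γ.c i.succ : Fin (m + 1) → Perm' n) = γ.c := by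
  funext i
  exact Fin.cases γ.c_zero.symm (fun _ => rfl) i

lemma LabeledChain.isPath_toList {m : ℕ} {u w : Perm' n} (γ : LabeledChain n m u w) :
    IsPath γ.toList u w := by
  rw [toList, isPath_ofFn]
  simp only [γ.cons_c]
  exact ⟨γ.step, γ.c_last⟩

lemma LabeledChain.pairwise_toList {m : ℕ} {u w : Perm' n} (γ : LabeledChain n m u w) :
    (γ.toList.map Prod.fst).Pairwise lexLt ↔ γ.Increasing := by
  rw [toList, List.map_ofFn, List.pairwise_ofFn]
  rfl

lemma LabeledChain.pathType_toList {m : ℕ} {u w : Perm' n} (γ : LabeledChain n m u w) :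
    ⇑(pathType γ.toList) = chainType γ := by
  funext k
  rw [pathType_apply, toList, List.map_ofFn, List.sum_ofFn, chainType, Finset.card_filter]
  rfl

lemma LabeledChain.toList_injective {u w : Perm' n} :
    Function.Injective fun x : (m : ℕ) × LabeledChain n m u w => x.2.toList := by
  rintro ⟨m, γ⟩ ⟨m', γ'⟩ h
  simp only [toList] at h
  obtain rfl : m = m' := by simpa using congrArg List.length h
  have h := List.ofFn_injective h
  have h1 : γ.lab = γ'.lab := funext fun i => congrArg Prod.fst (congrFun h i)
  have h2 : γ.c = γ'.c := by
    rw [← γ.cons_c, ← γ'.cons_c]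
    refine congrArg _ (funext fun i => congrArg Prod.snd (congrFun h i))
  cases γ
  cases γ'
  subst h1 h2
  rfl

lemma exists_toList_eq {p : List ((ℕ × ℕ) × Perm' n)} {u w : Perm' n} (h : IsPath p u w) :
    ∃ (m : ℕ) (γ : LabeledChain n m u w), γ.toList = p := by
  have hp : List.ofFn p.get = p := List.ofFn_get p
  rw [← hp, isPath_ofFn] at h
  exact ⟨p.length, ⟨_, fun i => (p.get i).1, rfl, h.2, h.1⟩, hp⟩

lemma card_paths (u w : Perm' n) (α : Fin n → ℕ) :
    ((paths (labels n) u w).filter fun p => ⇑(pathType p) = α).card = incChainCount n u w α := by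
  have hmem (x : (m : ℕ) × {γ : LabeledChain n m u w // γ.Increasing ∧ chainType γ = α}) :
      x.2.1.toList ∈ (paths (labels n) u w).filter fun p => ⇑(pathType p) = α := by
    rw [Finset.mem_filter, mem_paths, x.2.1.pathType_toList]
    exact ⟨⟨x.2.1.isPath_toList, (sublist_labels_iff x.2.1.isPath_toList.mem_labels).2
      (x.2.1.pairwise_toList.2 x.2.2.1)⟩, x.2.2.2⟩
  rw [incChainCount, ← Nat.card_eq_finsetCard]
  refine (Nat.card_eq_of_bijective (fun x => ⟨x.2.1.toList, hmem x⟩) ⟨?_, ?_⟩).symm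
  · rintro ⟨m, γ, hγ⟩ ⟨m', γ', hγ'⟩ h
    have h1 : (⟨m, γ⟩ : (m : ℕ) × LabeledChain n m u w) = ⟨m', γ'⟩ :=
      LabeledChain.toList_injective (Subtype.ext_iff.1 h)
    cases h1
    rfl
  · rintro ⟨p, hp⟩
    have hp' := hp
    rw [Finset.mem_filter, mem_paths] at hp'
    obtain ⟨m, γ, rfl⟩ := exists_toList_eq hp'.1.1
    exact ⟨⟨m, γ, γ.pairwise_toList.1 ((sublist_labels_iff hp'.1.1.mem_labels).1 hp'.1.2),
      γ.pathType_toList ▸ hp'.2⟩, rfl⟩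

end Paths

/-- The variables, extended by zero to all natural indices. -/
def tvar (n : ℕ) (k : ℕ) : MvPolynomial (Fin n) ℤ := if h : k < n then X ⟨k, h⟩ else 0

lemma tvar_val {n : ℕ} (k : Fin n) : tvar n k = X k := by simp [tvar]

lemma prod_tvar_eq_monomial {n : ℕ} {p : List ((ℕ × ℕ) × Perm' n)} {u w : Perm' n}
    (h : IsPath p u w) : (p.map fun e => tvar n e.1.1).prod = monomial (pathType p) 1 := by
  induction p generalizing u with
  | nil =>
    have : pathType ([] : List ((ℕ × ℕ) × Perm' n)) = 0 := by ext; simp [pathType_apply]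
    rw [this]; simp
  | cons e p ih =>
    have hk : e.1.1 < n := by
      obtain ⟨i, j, -, -, -, -, -, h6, -⟩ := h.1
      omega
    rw [List.map_cons, List.prod_cons, ih h.2, tvar, dif_pos hk, X, monomial_mul, one_mul]
    refine congrArg (fun d => monomial d (1 : ℤ)) ?_
    ext k
    rw [pathType_apply, List.map_cons, List.sum_cons, Finsupp.add_apply, pathType_apply,
      Finsupp.single_apply]
    simp [Fin.ext_iff]

lemma coeff_sum_paths {n : ℕ} (u w : Perm' n) (α : Fin n →₀ ℕ) :
    coeff α (∑ p ∈ paths (labels n) u w, (p.map fun e => tvar n e.1.1).prod) =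
      incChainCount n u w α := by
  rw [coeff_sum, ← card_paths, Finset.card_filter, Nat.cast_sum]
  refine Finset.sum_congr rfl fun p hp => ?_
  rw [prod_tvar_eq_monomial (mem_paths.1 hp).1, coeff_monomial, Nat.cast_ite]
  simp

section Det

variable {n : ℕ} {R : Type*} [CommRing R]

lemma coeff_prod_aeval_X (f : Fin n → Polynomial R) (d : Fin n →₀ ℕ) :
    coeff d (∏ i, Polynomial.aeval (X i : MvPolynomial (Fin n) R) (f i)) =
      ∏ i, (f i).coeff (d i) := by
  have h1 (i : Fin n) : Polynomial.aeval (X i : MvPolynomial (Fin n) R) (f i) =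
      ∑ j ∈ (f i).support, monomial (Finsupp.single i j) ((f i).coeff j) := by
    rw [Polynomial.aeval_def, Polynomial.eval₂_eq_sum, Polynomial.sum_def]
    refine Finset.sum_congr rfl fun j _ => ?_
    rw [X_pow_eq_monomial, algebraMap_eq, C_mul_monomial, mul_one]
  have h2 (p : Fin n → ℕ) : ∏ i, monomial (Finsupp.single i (p i)) ((f i).coeff (p i)) =
      monomial (Finsupp.equivFunOnFinite.symm p) (∏ i, (f i).coeff (p i)) := by
    rw [← monomial_sum_prod, Finsupp.equivFunOnFinite_symm_eq_sum]
  simp only [h1, Finset.prod_univ_sum, h2, coeff_sum, coeff_monomial]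
  rw [Finset.sum_eq_single ⇑d]
  · rw [if_pos (by ext; rfl)]
  · intro p _ hp
    exact if_neg fun h => hp (by rw [← h]; rfl)
  · intro h
    rw [if_pos (by ext; rfl)]
    simp only [Fintype.mem_piFinset, not_forall, Polynomial.mem_support_iff, not_not] at h
    obtain ⟨i, hi⟩ := h
    exact Finset.prod_eq_zero (Finset.mem_univ i) hi

lemma top_prod_aeval_X (f : Fin n → Polynomial R) :
    top (∏ i, Polynomial.aeval (X i : MvPolynomial (Fin n) R) (f i)) =
      (Matrix.of fun i j : Fin n => (f i).coeff (n - 1 - (j : ℕ))).det := by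
  rw [top_apply, ← Matrix.det_transpose, Matrix.det_apply]
  simp [coeff_prod_aeval_X, Units.smul_def]

lemma natDegree_prod_X_sub_C_le {ι : Type*} (s : Finset ι) (t : ι → R) :
    (∏ k ∈ s, (Polynomial.X - Polynomial.C (t k))).natDegree ≤ s.card :=
  (Polynomial.natDegree_prod_le _ _).trans <|
    (Finset.sum_le_card_nsmul _ _ 1 fun _ _ => Polynomial.natDegree_X_sub_C_le _).trans (by simp)

lemma reflect_prod_one_sub {ι : Type*} (s : Finset ι) (t : ι → R) :
    (∏ k ∈ s, (Polynomial.X - Polynomial.C (t k))).reflect s.card =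
      ∏ k ∈ s, (1 - Polynomial.C (t k) * Polynomial.X) := by
  classical
  induction s using Finset.induction_on with
  | empty => simp
  | insert a s ha ih =>
    rw [Finset.prod_insert ha, Finset.prod_insert ha, Finset.card_insert_of_notMem ha, add_comm,
      Polynomial.reflect_mul _ _ (Polynomial.natDegree_X_sub_C_le _)
        (natDegree_prod_X_sub_C_le _ _), ih]
    simp [Polynomial.reflect_sub]

lemma coeff_X_pow_mul_prod_one_sub (t : Fin n → R) {γ : ℕ} (i j : Fin n)
    (hγ : γ ≤ n - 1 - (i : ℕ)) :
    (Polynomial.X ^ γ * ∏ k ∈ Finset.Iio i, (1 - Polynomial.C (t k) * Polynomial.X)).coeff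
        (n - 1 - (j : ℕ)) =
      (Polynomial.X ^ (n - 1 - (i : ℕ) - γ) *
        ∏ k ∈ Finset.Iio i, (Polynomial.X - Polynomial.C (t k))).coeff j := by
  have hi : n - 1 = (n - 1 - (i : ℕ)) + (Finset.Iio i).card := by
    rw [Fin.card_Iio]
    omega
  have hr : (Polynomial.X ^ (n - 1 - (i : ℕ) - γ) *
      ∏ k ∈ Finset.Iio i, (Polynomial.X - Polynomial.C (t k))).reflect (n - 1) =
      Polynomial.X ^ γ * ∏ k ∈ Finset.Iio i, (1 - Polynomial.C (t k) * Polynomial.X) := by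
    have h := Polynomial.reflect_mul _ _ ((Polynomial.natDegree_X_pow_le (R := R) _).trans
      (Nat.sub_le (n - 1 - (i : ℕ)) γ)) (natDegree_prod_X_sub_C_le (Finset.Iio i) t)
    rw [← hi] at h
    rw [h, reflect_prod_one_sub, Polynomial.reflect_monomial, Polynomial.revAt_le (Nat.sub_le _ _),
      Nat.sub_sub_self hγ]
  rw [← hr, Polynomial.coeff_reflect, Polynomial.revAt_le (Nat.sub_le _ _),
    Nat.sub_sub_self (by omega)]

lemma top_monomial_mul_prod [IsDomain R] {t : Fin n → R} (ht : Function.Injective t)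
    {γ : Fin n →₀ ℕ} (hγ : ∀ i : Fin n, γ i ≤ n - 1 - (i : ℕ)) :
    top (monomial γ 1 * ∏ i : Fin n, ∏ k ∈ Finset.Iio i, (1 - C (t k) * X i)) =
      ∏ i : Fin n, t i ^ (n - 1 - (i : ℕ) - γ i) := by
  set g : Fin n → Polynomial R := fun i => Polynomial.X ^ (n - 1 - (i : ℕ) - γ i) *
    ∏ k ∈ Finset.Iio i, (Polynomial.X - Polynomial.C (t k)) with hg
  have h1 : (monomial γ 1 * ∏ i : Fin n, ∏ k ∈ Finset.Iio i, (1 - C (t k) * X i) :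
      MvPolynomial (Fin n) R) = ∏ i, Polynomial.aeval (X i) (Polynomial.X ^ γ i *
        ∏ k ∈ Finset.Iio i, (1 - Polynomial.C (t k) * Polynomial.X)) := by
    rw [monomial_eq, C_1, one_mul, Finsupp.prod_fintype _ _ (by simp), ← Finset.prod_mul_distrib]
    simp [map_prod, algebraMap_eq]
  have h2 : (Matrix.of fun i j : Fin n => (g i).coeff (j : ℕ)) * (Matrix.vandermonde t).transpose =
      Matrix.of fun i m => (g i).eval (t m) := by
    ext i m
    have hd : (g i).natDegree < n := by
      have h := Polynomial.natDegree_mul_le_of_le (Polynomial.natDegree_X_pow_le (R := R)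
        (n - 1 - (i : ℕ) - γ i)) (natDegree_prod_X_sub_C_le (Finset.Iio i) t)
      rw [Fin.card_Iio] at h
      exact lt_of_le_of_lt h (by omega)
    simp [Matrix.mul_apply, Matrix.vandermonde, Polynomial.eval_eq_sum_range' hd,
      Finset.sum_range]
  have h3 : (Matrix.of fun i m => (g i).eval (t m)).det =
      (∏ i : Fin n, t i ^ (n - 1 - (i : ℕ) - γ i)) * (Matrix.vandermonde t).det := by
    rw [Matrix.det_of_isUpperTriangular, Matrix.det_vandermonde, Finset.prod_comm'
      (t' := Finset.univ) (s' := fun j => Finset.Iio j) (by simp), ← Finset.prod_mul_distrib]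
    · simp [hg, Polynomial.eval_prod]
    · intro i m hm
      have hm : m < i := hm
      simp only [hg, Matrix.of_apply, Polynomial.eval_mul, Polynomial.eval_prod]
      rw [Finset.prod_eq_zero (Finset.mem_Iio.2 hm) (by simp), mul_zero]
  rw [h1, top_prod_aeval_X]
  simp only [coeff_X_pow_mul_prod_one_sub t _ _ (hγ _)]
  refine mul_right_cancel₀ (Matrix.det_vandermonde_ne_zero_iff.2 ht) ?_
  rw [← h3, ← h2, Matrix.det_mul, Matrix.det_transpose]

end Det

/-- The product of all `1 - t_k x_i` with `k < i`. -/
def skewKernel (n : ℕ) : MvPolynomial (Fin n) (MvPolynomial (Fin n) ℤ) :=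
  ((List.range n).map fun k => ∏ i with k < (i : Fin n).val, (1 - C (tvar n k) * X i)).prod

lemma skewKernel_eq (n : ℕ) : skewKernel n =
    ∏ i : Fin n, ∏ k ∈ Finset.Iio i, (1 - C (X k) * X i) := by
  rw [skewKernel, ← List.prod_toFinset _ List.nodup_range, List.toFinset_range, Finset.prod_range,
    Finset.prod_comm' (s' := Finset.Iio) (t' := Finset.univ) (by simp)]
  simp only [tvar_val]

lemma top_skewKernel_mul_map {n : ℕ} {f : MvPolynomial (Fin n) ℤ}
    (hf : ∀ d ∈ f.support, ∀ i : Fin n, d i ≤ n - 1 - (i : ℕ)) :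
    top (skewKernel n * MvPolynomial.map (Int.castRingHom (MvPolynomial (Fin n) ℤ)) f) =
      ∑ d ∈ f.support, coeff d f • ∏ i : Fin n, X i ^ (n - 1 - (i : ℕ) - d i) := by
  rw [skewKernel_eq]
  conv_lhs => rw [f.as_sum]
  rw [map_sum, Finset.mul_sum, map_sum]
  refine Finset.sum_congr rfl fun d hd => ?_
  rw [map_monomial, ← top_monomial_mul_prod X_injective (hf d hd)]
  have h : monomial d ((Int.castRingHom (MvPolynomial (Fin n) ℤ)) (coeff d f)) =
      coeff d f • monomial d (1 : MvPolynomial (Fin n) ℤ) := by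
    rw [smul_monomial, zsmul_one, eq_intCast]
  rw [h, mul_comm, smul_mul_assoc, map_zsmul]

/-- For `u ≤ w` and a composition `α` of `ℓ(w) - ℓ(u)` with
`α_i ≤ n - i`, the coefficient of `x^{δ-α}` in `S_{w/u}` is `I_α(u,w)`, the number
of increasing chains from `u` to `w` of type `α`. -/
theorem coeff_skew_schubert_eq_chain_count (n : ℕ)
    (S : Perm' n → MvPolynomial (Fin n) ℤ) (hS : IsSchubertFamily n S)
    (u w : Perm' n) (huw : BruhatLE u w)
    (α : Fin n → ℕ) (hsum : ∑ i, α i = invLength w - invLength u)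
    (hbd : ∀ i : Fin n, α i ≤ n - 1 - (i : ℕ))
    (skw : MvPolynomial (Fin n) ℤ)
    (hskw : IsNormalForm n (S u * S (w0 n * w)) skw) :
    MvPolynomial.coeff (Finsupp.equivFunOnFinite.symm fun i : Fin n => n - 1 - (i : ℕ) - α i) skw
      = (incChainCount n u w α : ℤ) := by
  have hF : IsFam fun v => MvPolynomial.map (Int.castRingHom (MvPolynomial (Fin n) ℤ)) (S v) := 
    hS.isFam.map _
  have key : top (skewKernel n * MvPolynomial.map (Int.castRingHom (MvPolynomial (Fin n) ℤ)) skw) =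
      ∑ p ∈ paths (labels n) u w, (p.map fun e => tvar n e.1.1).prod := by
    have h := hF.top_mul_map_eq_zero (skewKernel n) hskw.1
    rw [map_sub, mul_sub, map_sub, sub_eq_zero] at h
    rw [← h, ← prod_opA_apply (tvar n) (nodup_labels n),
      prod_labels n fun k b => (1 + tvar n k • opA k b :
        Module.End (MvPolynomial (Fin n) ℤ) (Perm' n → MvPolynomial (Fin n) ℤ))]
    have h1 := congrFun (hF.prod_opH_apply (tvar n) (List.range n)
      (MvPolynomial.map (Int.castRingHom (MvPolynomial (Fin n) ℤ)) (S (w0 n * w)))) u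
    have h2 : (fun v =>
        top (MvPolynomial.map (Int.castRingHom (MvPolynomial (Fin n) ℤ)) (S (w0 n * w)) *
          MvPolynomial.map (Int.castRingHom (MvPolynomial (Fin n) ℤ)) (S v))) =
        fun v => if v = w then 1 else 0 :=
      funext fun v => by rw [mul_comm, hF.duality]
    rw [h2] at h1
    refine Eq.trans ?_ h1.symm
    rw [← skewKernel, RingHom.map_mul, mul_comm (MvPolynomial.map _ (S u)), ← mul_assoc,
      mul_comm (skewKernel n)]
  rw [top_skewKernel_mul_map hskw.2] at key
  have hα := coeff_sum_paths u w (Finsupp.equivFunOnFinite.symm α)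
  rw [← key, coeff_sum] at hα
  refine Eq.trans ?_ hα
  have hX (e : Fin n → ℕ) : ∏ i : Fin n, (X i : MvPolynomial (Fin n) ℤ) ^ e i =
      monomial (Finsupp.equivFunOnFinite.symm e) 1 := by
    rw [monomial_eq, C_1, one_mul, Finsupp.prod_fintype _ _ (by simp)]
    rfl
  simp only [hX, coeff_smul, coeff_monomial]
  rw [Finset.sum_eq_single (Finsupp.equivFunOnFinite.symm fun i : Fin n => n - 1 - (i : ℕ) - α i)]
  · rw [if_pos, smul_eq_mul, mul_one]
    ext i
    exact Nat.sub_sub_self (hbd i)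
  · intro d hd hne
    rw [if_neg, smul_zero]
    refine fun h => hne ?_
    ext i
    have h1 : n - 1 - (i : ℕ) - d i = α i := DFunLike.congr_fun h i
    have h2 := hskw.2 d hd i
    change d i = n - 1 - (i : ℕ) - α i
    omega
  · intro h
    rw [notMem_support_iff.1 h, zero_smul]
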